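/- arXiv:1504.03129 — 2 statements merged into one kernel-verified Lean document; each statement's English description precedes it below -/
import Mathlib

section
/- Let t ≥ 1 and x_1,…,x_t, y_1,…,y_t ≥ 1 be integers with ∑_{i=1}^t y_i = ∑_{i=1}^t x_i + 4 ≥ 6, and let Λ_Γ be the lattice associated with these data and d = 1. Suppose that for some k ≥ 1 there is an isometric embedding Λ_Γ^k ⊂ Z^N of finite and odd index, where N = k·∑_{i=1}^t y_i. Then the string of positive integers (x_1+2, 2,…,2 (y_1−1 times), x_2+2, 2,…,2 (y_2−1 times), …, x_t+2, 2,…,2 (y_t−1 times)) is obtained from an iterated blowup of (0,0) containing exactly two entries equal to 1 by replacing those two entries 1 with 2. -/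
open Finset

/-- The standard negative definite bilinear form on `ℤ^N`:
`x·y = -∑ i, x i * y i`. -/
def negForm (N : ℕ) (u v : Fin N → ℤ) : ℤ := -∑ i, u i * v i

/-- A canonical basis of `ℤ^N`: a set of `N` vectors with `e·e = -1` and
distinct elements pairwise orthogonal. -/
def IsCanonicalBasis (N : ℕ) (E : Finset (Fin N → ℤ)) : Prop :=
  E.card = N ∧ (∀ e ∈ E, negForm N e e = -1) ∧
    ∀ e ∈ E, ∀ f ∈ E, e ≠ f → negForm N e f = 0

/-- The equivalence relation on `ℤ^N` generated by `u ~ v` iff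
`u, v ∈ V` and `u·v ≠ 0`. -/
def Conn (N : ℕ) (V : Finset (Fin N → ℤ)) : (Fin N → ℤ) → (Fin N → ℤ) → Prop :=
  Relation.EqvGen fun u v => u ∈ V ∧ v ∈ V ∧ negForm N u v ≠ 0

open scoped Classical in
/-- The connected component of `v` in `V`. -/
noncomputable def compOf (N : ℕ) (V : Finset (Fin N → ℤ)) (v : Fin N → ℤ) :
    Finset (Fin N → ℤ) :=
  V.filter fun u => Conn N V u v

/-- A circular subset of `ℤ^N`. -/
def IsCircular (N : ℕ) (V : Finset (Fin N → ℤ)) : Prop :=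
  (∀ v ∈ V, 3 ≤ (compOf N V v).card) ∧
  (∀ u ∈ V, ∀ v ∈ V, u ≠ v →
    negForm N u v = -1 ∨ negForm N u v = 0 ∨ negForm N u v = 1) ∧
  (∀ v ∈ V,
    (V.filter fun u => u ≠ v ∧ (negForm N u v = 1 ∨ negForm N u v = -1)).card = 2)

/-- `E` is a canonical basis adapted to `V`:  `∑_{v ∈ V} v = -∑_{e ∈ E} e`. -/
def IsAdaptedBasis (N : ℕ) (E V : Finset (Fin N → ℤ)) : Prop :=
  IsCanonicalBasis N E ∧ (∑ v ∈ V, v) = -∑ e ∈ E, e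

open scoped Classical in
/-- A semipositive circular subset: each connected component contains exactly one
(unordered) pair of distinct vectors `u, v` with `u·v = -1`. -/
def IsSemipositive (N : ℕ) (V : Finset (Fin N → ℤ)) : Prop :=
  IsCircular N V ∧ ∀ v₀ ∈ V,
    (((compOf N V v₀) ×ˢ (compOf N V v₀)).filter fun p =>
      p.1 ≠ p.2 ∧ negForm N p.1 p.2 = -1).card = 2

/-- A positive circular subset: `u·v ≥ 0` for all distinct `u, v ∈ V`. -/
def IsPositive (N : ℕ) (V : Finset (Fin N → ℤ)) : Prop :=
  IsCircular N V ∧ ∀ u ∈ V, ∀ v ∈ V, u ≠ v → 0 ≤ negForm N u v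

/-- A single blowup of a string of nonnegative integers. -/
inductive IsBlowup : List ℕ → List ℕ → Prop
  | left (a b : ℕ) (m : List ℕ) :
      IsBlowup (a :: (m ++ [b])) (1 :: (a + 1) :: (m ++ [b + 1]))
  | middle (a b : ℕ) (p s : List ℕ) :
      IsBlowup (p ++ a :: b :: s) (p ++ (a + 1) :: 1 :: (b + 1) :: s)
  | right (a b : ℕ) (m : List ℕ) :
      IsBlowup (a :: (m ++ [b])) ((a + 1) :: (m ++ [b + 1, 1]))

/-- An iterated blowup of `(0,0)`. -/
def IsIteratedBlowup (s : List ℕ) : Prop :=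
  Relation.ReflTransGen IsBlowup [0, 0] s

/-- A `(-2)`-expansion of a string of negative integers. -/
inductive IsNeg2Expansion : List ℤ → List ℤ → Prop
  | first (l : List ℤ) (a : ℤ) :
      IsNeg2Expansion (-2 :: (l ++ [a])) (-2 :: -2 :: (l ++ [a - 1]))
  | second (a : ℤ) (l : List ℤ) :
      IsNeg2Expansion (-2 :: a :: l) (-2 :: (a - 1) :: (l ++ [-2]))

/-- A cyclic listing of (the elements of) a connected component `C` of a circular
subset: a cyclically indexed enumeration of `C` in which consecutive elements
pair to `±1`. -/
def IsCyclicListing (N : ℕ) (C : Finset (Fin N → ℤ)) (m : ℕ)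
    (w : ZMod m → (Fin N → ℤ)) : Prop :=
  C.card = m ∧ Function.Injective w ∧ (∀ i, w i ∈ C) ∧ (∀ c ∈ C, ∃ i, w i = c) ∧
    ∀ i : ZMod m, negForm N (w i) (w (i + 1)) = 1 ∨ negForm N (w i) (w (i + 1)) = -1

/-- The index in the cyclic string at which the `i`-th block starts. -/
def blockStart {t : ℕ} (y : Fin t → ℕ) (i : Fin t) : ℕ := ∑ i' ∈ Finset.Iio i, y i'

/-- The string of squares `(-x₁-2, -2,…,-2, …, -xₜ-2, -2,…,-2)` of the lattice
`Λ_Γ`, as a function on `Fin n` (where `n = ∑ yᵢ`). -/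
def sqOf {t : ℕ} (x y : Fin t → ℕ) (n : ℕ) (j : Fin n) : ℤ :=
  -2 - ∑ i : Fin t, if (j : ℕ) = blockStart y i then (x i : ℤ) else 0

/-- The Gram matrix of the lattice `Λ_Γ`: diagonal given by `sq`, consecutive
vertices pair to `1`, the last and first vertices pair to `(-1)^d`, all other
pairs are orthogonal. -/
def gramOf (n : ℕ) (sq : Fin n → ℤ) (d : ℕ) (i j : Fin n) : ℤ :=
  if i = j then sq i
  else if (j : ℕ) = (i : ℕ) + 1 ∨ (i : ℕ) = (j : ℕ) + 1 then 1
  else if ((i : ℕ) = 0 ∧ (j : ℕ) = n - 1) ∨ ((j : ℕ) = 0 ∧ (i : ℕ) = n - 1)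
    then (-1) ^ d
  else 0

/-- The elementary factor of the monodromy, acting on row vectors by
`(p, q) ↦ (c * p - q, p)`. -/
def stepMatrix (c : ℕ) : Matrix (Fin 2) (Fin 2) ℚ := !![(c : ℚ), 1; -1, 0]

/-- The monodromy of a string. -/
def monodromy (l : List ℕ) : Matrix (Fin 2) (Fin 2) ℚ := (l.map stepMatrix).prod

theorem monodromy_cons (a : ℕ) (l : List ℕ) :
    monodromy (a :: l) = stepMatrix a * monodromy l := by
  simp [monodromy]

theorem monodromy_append (l m : List ℕ) :
    monodromy (l ++ m) = monodromy l * monodromy m := by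
  simp [monodromy]

theorem monodromy_singleton (a : ℕ) : monodromy [a] = stepMatrix a := by
  simp [monodromy]

theorem stepMatrix_blowup (a b : ℕ) :
    stepMatrix (a + 1) * (stepMatrix 1 * stepMatrix (b + 1)) =
      stepMatrix a * stepMatrix b := by
  ext i j
  fin_cases i <;> fin_cases j <;>
    simp [stepMatrix, Matrix.mul_apply, Fin.sum_univ_two] <;> ring

theorem stepMatrix_zero_mid (a b : ℕ) :
    stepMatrix a * (stepMatrix 0 * stepMatrix b) = -stepMatrix (a + b) := by
  ext i j
  fin_cases i <;> fin_cases j <;>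
    simp [stepMatrix, Matrix.mul_apply, Fin.sum_univ_two] <;> ring

/-- The monodromy of the string is `1` or `-1`. -/
def TrivialMonodromy (l : List ℕ) : Prop := monodromy l = 1 ∨ monodromy l = -1

theorem TrivialMonodromy.rotate {l m : List ℕ} (h : TrivialMonodromy (l ++ m)) :
    TrivialMonodromy (m ++ l) := by
  unfold TrivialMonodromy at *
  rw [monodromy_append] at *
  rcases h with h | h
  · exact Or.inl (mul_eq_one_comm.1 h)
  · refine Or.inr (neg_eq_iff_eq_neg.1 ?_)
    rw [← neg_mul]
    apply mul_eq_one_comm.1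
    rw [mul_neg, h, neg_neg]

theorem not_trivialMonodromy_singleton (a : ℕ) : ¬ TrivialMonodromy [a] := by
  rintro (h | h)
  all_goals
    have := congrFun (congrFun h 0) 1
    simp [monodromy, stepMatrix] at this

theorem monodromy_row_growth (m : List ℕ) (h : ∀ a ∈ m, 2 ≤ a) :
    0 ≤ monodromy m 0 1 ∧ monodromy m 0 1 < monodromy m 0 0 := by
  induction m using List.reverseRecOn with
  | nil => simp [monodromy]
  | append_singleton m c ih =>
    obtain ⟨h0, h1⟩ := ih fun a ha => h a (by simp [ha])
    have hc : (2 : ℚ) ≤ c := by exact_mod_cast h c (by simp)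
    rw [monodromy_append, monodromy_singleton]
    simp only [stepMatrix, Matrix.mul_apply, Fin.sum_univ_two, Matrix.of_apply,
      Matrix.cons_val', Matrix.cons_val_zero, Matrix.cons_val_one, Matrix.cons_val_fin_one]
    constructor <;> nlinarith

theorem not_trivialMonodromy_of_two_le (m s : List ℕ) (e : ℕ) (hm : ∀ a ∈ m, 2 ≤ a)
    (hs : ∀ a ∈ s, 2 ≤ a) : ¬ TrivialMonodromy (m ++ e :: s) := by
  intro h
  have h' : TrivialMonodromy ((s ++ m) ++ [e]) := by
    have := TrivialMonodromy.rotate (l := m ++ [e]) (m := s) (by simpa using h)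
    simpa using this
  obtain ⟨h0, h1⟩ := monodromy_row_growth (s ++ m) (by
    intro a ha
    rcases List.mem_append.1 ha with ha | ha
    exacts [hs a ha, hm a ha])
  have key : (monodromy ((s ++ m) ++ [e])) 0 1 = monodromy (s ++ m) 0 0 := by
    rw [monodromy_append, monodromy_singleton]
    simp [stepMatrix, Matrix.mul_apply, Fin.sum_univ_two]
  have : (monodromy ((s ++ m) ++ [e])) 0 1 = 0 := by
    rcases h' with h' | h' <;> rw [h'] <;> simp
  linarith

theorem two_le_count_one {l : List ℕ} (hl : l ≠ []) (h : TrivialMonodromy l)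
    (hpos : ∀ a ∈ l, 1 ≤ a) : 2 ≤ l.count 1 := by
  have of_not_mem : ∀ m : List ℕ, (∀ a ∈ m, 1 ≤ a) → 1 ∉ m → ∀ a ∈ m, 2 ≤ a := by
    intro m hm h1 a ha
    have := hm a ha
    have : a ≠ 1 := fun h => h1 (h ▸ ha)
    omega
  by_cases h1 : 1 ∈ l
  · obtain ⟨p, s, rfl⟩ := List.append_of_mem h1
    by_contra hc
    simp only [List.count_append, List.count_cons_self] at hc
    have hp : 1 ∉ p := by rw [← List.count_eq_zero]; omega
    have hs : 1 ∉ s := by rw [← List.count_eq_zero]; omega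
    exact not_trivialMonodromy_of_two_le p s 1
      (of_not_mem p (fun a ha => hpos a (by simp [ha])) hp)
      (of_not_mem s (fun a ha => hpos a (by simp [ha])) hs) h
  · obtain ⟨a, m, rfl⟩ := List.exists_cons_of_ne_nil hl
    exact (not_trivialMonodromy_of_two_le [] m a (by simp)
      (fun b hb => of_not_mem _ hpos h1 b (by simp [hb])) h).elim

theorem TrivialMonodromy.blowdown {p s : List ℕ} {a b : ℕ}
    (h : TrivialMonodromy (p ++ (a + 1) :: 1 :: (b + 1) :: s)) :
    TrivialMonodromy (p ++ a :: b :: s) := by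
  have : monodromy (p ++ (a + 1) :: 1 :: (b + 1) :: s) = monodromy (p ++ a :: b :: s) := by
    simp only [monodromy_append, monodromy_cons]
    rw [← mul_assoc (stepMatrix a), ← stepMatrix_blowup]
    simp only [mul_assoc]
  unfold TrivialMonodromy at *
  rwa [this] at h

theorem TrivialMonodromy.contract_zero {s : List ℕ} {a b : ℕ}
    (h : TrivialMonodromy (a :: 0 :: b :: s)) : TrivialMonodromy ((a + b) :: s) := by
  have : monodromy (a :: 0 :: b :: s) = -monodromy ((a + b) :: s) := by
    simp only [monodromy_cons]
    rw [← neg_mul, ← stepMatrix_zero_mid]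
    simp only [mul_assoc]
  unfold TrivialMonodromy at *
  rw [this] at h
  rcases h with h | h
  · exact Or.inr (neg_eq_iff_eq_neg.1 h)
  · exact Or.inl (neg_injective h)

theorem exists_cons_concat {l : List ℕ} (h : 2 ≤ l.length) :
    ∃ a m b, l = a :: (m ++ [b]) := by
  match l, h with
  | a :: c :: l, _ =>
    obtain ⟨m, b, hm⟩ : ∃ m b, c :: l = m ++ [b] :=
      ⟨_, _, (List.dropLast_append_getLast (List.cons_ne_nil c l)).symm⟩
    exact ⟨a, m, b, by rw [hm]⟩

theorem TrivialMonodromy.sum_add_lt_of_zero_mem {l : List ℕ} (hl : 3 ≤ l.length)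
    (h : TrivialMonodromy l) (h0 : 0 ∈ l)
    (ih : ∀ m : List ℕ, m.length < l.length → 2 ≤ m.length → TrivialMonodromy m →
      m.sum + 6 ≤ 3 * m.length) : l.sum + 6 < 3 * l.length := by
  obtain ⟨p, s, rfl⟩ := List.append_of_mem h0
  simp only [List.length_append, List.length_cons] at hl
  obtain ⟨b, m, a, hm⟩ := exists_cons_concat (l := s ++ p) (by simp; omega)
  have hlen := congrArg List.length hm
  have hsum := congrArg List.sum hm
  simp only [List.length_append, List.length_cons, List.sum_append, List.sum_cons,
    List.length_nil, List.sum_nil] at hlen hsum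
  have h1 : TrivialMonodromy (0 :: (s ++ p)) := by simpa using h.rotate
  rw [hm] at h1
  have h2 : TrivialMonodromy (a :: 0 :: b :: m) := by
    have := TrivialMonodromy.rotate (l := 0 :: b :: m) (m := [a]) (by simpa using h1)
    simpa using this
  have h3 := h2.contract_zero
  rcases m with _ | ⟨c, m⟩
  · exact (not_trivialMonodromy_singleton _ h3).elim
  · have := ih _ (by simp at hlen ⊢; omega) (by simp) h3
    simp only [List.sum_cons, List.length_cons, List.sum_append, List.length_append]
      at this hlen hsum ⊢
    omega

theorem TrivialMonodromy.sum_le {l : List ℕ} (hl : 2 ≤ l.length) (h : TrivialMonodromy l) :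
    l.sum + 6 ≤ 3 * l.length ∧ (l.sum + 6 = 3 * l.length → IsIteratedBlowup l) := by
  induction hn : l.length using Nat.strong_induction_on generalizing l with
  | _ n ih =>
  subst hn
  rcases hl.eq_or_lt with h2 | h3
  · obtain ⟨a, b, rfl⟩ := List.length_eq_two.1 h2.symm
    have hab : a = 0 ∧ b = 0 := by
      rcases h with h | h
      all_goals
        have e1 := congrFun (congrFun h 0) 1
        have e2 := congrFun (congrFun h 1) 0
        simp [monodromy, stepMatrix, Matrix.mul_apply, Fin.sum_univ_two] at e1 e2
        exact ⟨e1, e2⟩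
    obtain ⟨rfl, rfl⟩ := hab
    exact ⟨by simp, fun _ => Relation.ReflTransGen.refl⟩
  by_cases h0 : 0 ∈ l
  · have := h.sum_add_lt_of_zero_mem h3 h0 fun m hm h2 h => (ih _ hm h2 h rfl).1
    exact ⟨this.le, fun h => by omega⟩
  have hpos : ∀ a ∈ l, ∃ b, a = b + 1 := fun a ha =>
    Nat.exists_eq_succ_of_ne_zero fun h => h0 (h ▸ ha)
  have h1 : 1 ∈ l := by
    have := two_le_count_one (l := l) (by rintro rfl; simp at hl) h
      (fun a ha => by obtain ⟨b, rfl⟩ := hpos a ha; omega)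
    exact List.count_pos_iff.1 (by omega)
  obtain ⟨m, hb, hm, hlen, hsum⟩ : ∃ m, IsBlowup m l ∧ TrivialMonodromy m ∧
      l.length = m.length + 1 ∧ l.sum = m.sum + 3 := by
    obtain ⟨p, s, rfl⟩ := List.append_of_mem h1
    rcases List.eq_nil_or_concat p with rfl | ⟨p, a, rfl⟩
    · obtain ⟨a, m, b, rfl⟩ := exists_cons_concat (l := s) (by simp at h3; omega)
      obtain ⟨a, rfl⟩ := hpos a (by simp)
      obtain ⟨b, rfl⟩ := hpos b (by simp)
      refine ⟨a :: (m ++ [b]), IsBlowup.left a b m, ?_, by simp, by simp; omega⟩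
      have := TrivialMonodromy.blowdown (p := []) (a := b) (b := a) (s := m) (by
        have := TrivialMonodromy.rotate (l := 1 :: (a + 1) :: m) (m := [b + 1])
          (by simpa using h)
        simpa using this)
      simpa using TrivialMonodromy.rotate (l := [b]) (m := a :: m) (by simpa using this)
    rcases s with _ | ⟨b, s⟩
    · obtain ⟨a', m, b, hp⟩ := exists_cons_concat (l := p ++ [a])
        (by simp at h3 ⊢; omega)
      simp only [List.concat_eq_append] at *
      rw [hp] at *
      obtain ⟨a', rfl⟩ := hpos a' (by simp)
      obtain ⟨b, rfl⟩ := hpos b (by simp)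
      refine ⟨a' :: (m ++ [b]), by simpa using IsBlowup.right a' b m, ?_, by simp,
        by simp; omega⟩
      have := TrivialMonodromy.blowdown (p := []) (a := b) (b := a') (s := m) (by
        have := TrivialMonodromy.rotate (l := (a' + 1) :: m) (m := [b + 1, 1])
          (by simpa using h)
        simpa using this)
      simpa using TrivialMonodromy.rotate (l := [b]) (m := a' :: m) (by simpa using this)
    · simp only [List.concat_eq_append] at *
      obtain ⟨a, rfl⟩ := hpos a (by simp)
      obtain ⟨b, rfl⟩ := hpos b (by simp)
      refine ⟨p ++ a :: b :: s, by simpa using IsBlowup.middle a b p s, ?_, by simp; omega,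
        by simp; omega⟩
      exact TrivialMonodromy.blowdown (by simpa using h)
  obtain ⟨i1, i2⟩ := ih m.length (by omega) (l := m) (by omega) hm rfl
  exact ⟨by omega, fun he => (i2 (by omega)).tail hb⟩

theorem TrivialMonodromy.zero_notMem {l : List ℕ} (hl : 3 ≤ l.length)
    (h : TrivialMonodromy l) (hsum : l.sum + 6 = 3 * l.length) : 0 ∉ l := fun h0 =>
  (h.sum_add_lt_of_zero_mem hl h0 fun _ _ h2 hm => (hm.sum_le h2).1).ne hsum

theorem vecMul_monodromy (c : ℕ → ℕ) (X : ℕ → ℚ) (n : ℕ)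
    (h : ∀ j < n, X (j + 2) = c j * X (j + 1) - X j) :
    Matrix.vecMul ![X 1, X 0] (monodromy ((List.range n).map c)) = ![X (n + 1), X n] := by
  induction n with
  | zero => simp [monodromy]
  | succ n ih =>
    rw [List.range_succ, List.map_append, monodromy_append, ← Matrix.vecMul_vecMul,
      ih fun j hj => h j (by omega)]
    ext i
    fin_cases i
    · simp [monodromy, stepMatrix, Matrix.vecMul, dotProduct, Fin.sum_univ_two, h n (by omega)]
      ring
    · simp [monodromy, stepMatrix, Matrix.vecMul, dotProduct, Fin.sum_univ_two]

/-- The numerical data of the string attached to `x` and `y`, by position. -/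
def blockEntry {t : ℕ} (x y : Fin t → ℕ) (j : ℕ) : ℕ :=
  2 + ∑ i : Fin t, if j = blockStart y i then x i else 0

theorem flatten_blocks {t : ℕ} (x y : Fin t → ℕ) (hy : ∀ i, 1 ≤ y i) :
    (List.ofFn fun i : Fin t => (x i + 2) :: List.replicate (y i - 1) 2).flatten =
      (List.range (∑ i, y i)).map (blockEntry x y) := by
  induction t with
  | zero => simp
  | succ t ih =>
    have hlast : blockStart y (Fin.last t) = ∑ i : Fin t, y i.castSucc := by
      unfold blockStart
      rw [show Finset.Iio (Fin.last t) = Finset.univ.map Fin.castSuccEmb by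
        ext i; simp [Fin.exists_castSucc_eq]]
      simp
    have hcast : ∀ i : Fin t, blockStart y i.castSucc =
        blockStart (fun i => y i.castSucc) i := by
      intro i
      unfold blockStart
      rw [← Fin.map_castSuccEmb_Iio, Finset.sum_map]
      rfl
    have hlt : ∀ i : Fin t, blockStart y i.castSucc < ∑ i : Fin t, y i.castSucc := by
      intro i
      rw [hcast]
      unfold blockStart
      refine Finset.sum_lt_sum_of_subset (Finset.subset_univ _) (Finset.mem_univ i)
        (by simp) (by have := hy i.castSucc; omega) (by simp)
    rw [List.ofFn_succ', List.concat_eq_append, List.flatten_append, ih _ _ fun i => hy _,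
      Fin.sum_univ_castSucc, List.range_add, List.map_append]
    congr 1
    · apply List.map_congr_left
      intro j hj
      rw [List.mem_range] at hj
      simp [blockEntry, Fin.sum_univ_castSucc, hcast, hlast, hj.ne]
    · have hz : ∀ j, ∑ i : Fin t, (if ∑ i : Fin t, y i.castSucc + j = blockStart y i.castSucc
          then x i.castSucc else 0) = 0 := by
        intro j
        refine Finset.sum_eq_zero fun i _ => if_neg ?_
        have := hlt i
        omega
      obtain ⟨m, hm⟩ := Nat.exists_eq_add_of_le' (hy (Fin.last t))
      rw [hm, List.range_succ_eq_map]
      have hne : ∀ i : Fin t, ∑ i : Fin t, y i.castSucc ≠ blockStart y i.castSucc :=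
        fun i => (hlt i).ne'
      simp [blockEntry, Fin.sum_univ_castSucc, hlast, hz, hne, add_comm 2, List.map_map,
        Function.comp_def]

theorem sqOf_eq {t : ℕ} (x y : Fin t → ℕ) (n : ℕ) (j : Fin n) :
    sqOf x y n j = -(blockEntry x y j : ℤ) := by
  simp only [sqOf, blockEntry]
  push_cast
  ring

theorem sum_gramOf_mul {R : Type*} [CommRing R] {n : ℕ} (hn : 3 ≤ n) (sq : Fin n → ℤ)
    (j : Fin n) (x : Fin n → R) :
    ∑ l, (gramOf n sq 1 j l : R) * x l = sq j * x j +
      (if h : (j : ℕ) + 1 < n then x ⟨j + 1, h⟩ else -x ⟨0, by omega⟩) +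
      (if 0 < (j : ℕ) then x ⟨j - 1, by omega⟩ else -x ⟨n - 1, by omega⟩) := by
  have key : ∀ l, gramOf n sq 1 j l = (if l = j then sq j else 0) +
      (if h : (j : ℕ) + 1 < n then (if l = ⟨j + 1, h⟩ then 1 else 0)
        else (if l = ⟨0, by omega⟩ then -1 else 0)) +
      (if 0 < (j : ℕ) then (if l = ⟨j - 1, by omega⟩ then 1 else 0)
        else (if l = ⟨n - 1, by omega⟩ then -1 else 0)) := by
    intro l
    have := j.2
    have := l.2
    simp only [gramOf, Fin.ext_iff]
    split_ifs <;> omega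
  simp only [key]
  split_ifs <;>
    simp [add_mul, Finset.sum_add_distrib, ite_mul]

theorem even_sum_gramOf_sub {n : ℕ} (hn : 3 ≤ n) (sq : Fin n → ℤ) (j : Fin n) :
    Even (∑ l, gramOf n sq 1 j l - sq j) := by
  have h := sum_gramOf_mul (R := ℤ) hn sq j fun _ => 1
  simp only [mul_one, Int.cast_id] at h
  rw [h]
  split_ifs
  exacts [⟨1, by ring⟩, ⟨0, by ring⟩, ⟨0, by ring⟩, ⟨-1, by ring⟩]

theorem even_add_sum_sq {κ : Type*} (s : Finset κ) (f : κ → ℤ) :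
    Even (∑ i ∈ s, f i + ∑ i ∈ s, f i ^ 2) := by
  rw [← Finset.sum_add_distrib]
  refine Finset.even_sum _ fun i _ => ?_
  have := Int.even_mul_succ_self (f i)
  rwa [show f i + f i ^ 2 = f i * (f i + 1) by ring]

/-- If the sum of a family is characteristic on the family, and the family spans a
subgroup of odd index, then the coordinates of the sum are odd. -/
theorem odd_column_sum {κ : Type*} [Fintype κ] {N : ℕ} (w : κ → Fin N → ℤ)
    (hrow : ∀ p, Even (∑ q, ∑ i, w p i * w q i + ∑ i, w p i ^ 2))
    (hodd : Odd (AddSubgroup.closure (Set.range w)).index) (i : Fin N) :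
    Odd (∑ q, w q i) := by
  have hclosure : ∀ u ∈ AddSubgroup.closure (Set.range w),
      Even (∑ i, u i * (∑ q, w q i + 1)) := by
    intro u hu
    induction hu using AddSubgroup.closure_induction with
    | mem u hu =>
      obtain ⟨p, rfl⟩ := hu
      have h1 := hrow p
      have h2 := even_add_sum_sq Finset.univ (w p)
      rw [Finset.sum_comm] at h1
      simp only [mul_add, mul_one, Finset.sum_add_distrib, Finset.mul_sum]
      rw [Int.even_add] at *
      tauto
    | zero => simp
    | add u v _ _ hu hv =>
      simp only [Pi.add_apply, add_mul, Finset.sum_add_distrib]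
      exact hu.add hv
    | neg u _ hu =>
      simp only [Pi.neg_apply, neg_mul, Finset.sum_neg_distrib]
      exact hu.neg
  have h := hclosure _ (AddSubgroup.nsmul_index_mem _ (Pi.single i (1 : ℤ)))
  simp only [Pi.smul_apply, nsmul_eq_mul, Pi.single_apply, mul_ite, mul_one, mul_zero,
    ite_mul, zero_mul, Finset.sum_ite_eq', Finset.mem_univ, if_true] at h
  have h' : ¬ Even ((AddSubgroup.closure (Set.range w)).index : ℤ) := by
    rw [Int.not_even_iff_odd]
    exact_mod_cast hodd
  have h2 := (Int.even_mul.1 h).resolve_left h'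
  rw [Int.even_add_one, Int.not_even_iff_odd] at h2
  exact h2

/-- The coordinates in which a family of vectors has total energy one. -/
def privateCoords {κ : Type*} [Fintype κ] {N : ℕ} (w : κ → Fin N → ℤ) : Finset (Fin N) :=
  Finset.univ.filter fun i => ∑ p, w p i ^ 2 = 1

theorem le_energy_add_card_privateCoords {κ : Type*} [Fintype κ] {N : ℕ}
    (w : κ → Fin N → ℤ) (hcol : ∀ i, Odd (∑ p, w p i)) :
    3 * (N : ℤ) ≤ ∑ p, ∑ i, w p i ^ 2 + 2 * (privateCoords w).card := by
  rw [Finset.sum_comm]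
  have h : ∀ i, (3 : ℤ) ≤ ∑ p, w p i ^ 2 + if ∑ p, w p i ^ 2 = 1 then 2 else 0 := by
    intro i
    have h1 : Odd (∑ p, w p i ^ 2) := by
      have h2 := even_add_sum_sq Finset.univ fun p => w p i
      rw [Int.even_add] at h2
      rw [← Int.not_even_iff_odd, ← h2, Int.not_even_iff_odd]
      exact hcol i
    have h0 : 0 ≤ ∑ p, w p i ^ 2 := Finset.sum_nonneg fun p _ => sq_nonneg _
    obtain ⟨m, hm⟩ := h1
    split_ifs <;> omega
  have h3 := Finset.sum_le_sum fun i (_ : i ∈ Finset.univ) => h i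
  rw [Finset.sum_add_distrib, ← Finset.sum_filter] at h3
  simp only [Finset.sum_const, Finset.card_univ, Fintype.card_fin, nsmul_eq_mul] at h3
  unfold privateCoords
  linarith

theorem mul_eq_zero_of_mem_privateCoords {κ : Type*} [Fintype κ] {N : ℕ}
    {w : κ → Fin N → ℤ} {i : Fin N} (hi : i ∈ privateCoords w) {p q : κ} (hpq : p ≠ q) :
    w p i * w q i = 0 := by
  classical
  have h1 : ∑ p, w p i ^ 2 = 1 := by simpa [privateCoords] using hi
  have h2 : ∑ r ∈ {p, q}, w r i ^ 2 ≤ ∑ r, w r i ^ 2 :=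
    Finset.sum_le_sum_of_subset_of_nonneg (Finset.subset_univ _) fun _ _ _ => sq_nonneg _
  rw [Finset.sum_pair hpq, h1] at h2
  by_contra h
  obtain ⟨hp, hq⟩ := mul_ne_zero_iff.1 h
  have := Int.add_one_le_iff.2 (sq_pos_of_ne_zero hp)
  have := Int.add_one_le_iff.2 (sq_pos_of_ne_zero hq)
  omega

/-- The antiperiodic extension of a vector, shifted by one. -/
def antiperiodicExtension {n : ℕ} (hn : 0 < n) (x : Fin n → ℚ) : ℕ → ℚ
  | 0 => -x ⟨n - 1, by omega⟩
  | j + 1 => if h : j < n then x ⟨j, h⟩ else -x ⟨0, hn⟩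

theorem antiperiodicExtension_rec {n : ℕ} (hn : 3 ≤ n) (c : ℕ → ℕ) (x : Fin n → ℚ)
    (hx : ∀ j, ∑ l, (gramOf n (fun j => -(c j : ℤ)) 1 j l : ℚ) * x l = 0)
    (j : ℕ) (hj : j < n) :
    antiperiodicExtension (by omega) x (j + 2) =
      c j * antiperiodicExtension (by omega) x (j + 1) -
        antiperiodicExtension (by omega) x j := by
  have h := hx ⟨j, hj⟩
  rw [sum_gramOf_mul hn] at h
  push_cast at h
  rcases j with _ | j
  · simp only [antiperiodicExtension, hj, dif_pos] at h ⊢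
    simp only [lt_irrefl, if_false] at h
    linear_combination h
  · have : j < n := by omega
    simp only [antiperiodicExtension, hj, this, dif_pos] at h ⊢
    simp only [Nat.succ_pos, if_true, Nat.add_sub_cancel] at h
    linear_combination h

/-- A family of integral vectors whose Gram matrix is a block sum of antiperiodic cycles
spans a space of codimension at most two per cycle. In the extremal case all cycles have
monodromy `-1`. -/
theorem monodromy_eq_neg_one {k n : ℕ} (hn : 3 ≤ n) {κ : Type*} [Fintype κ]
    (u : Fin k × Fin n → κ → ℤ) (c : Fin k → ℕ → ℕ)
    (hu : ∀ p q, ∑ i, u p i * u q i =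
      if p.1 = q.1 then -gramOf n (fun j => -(c p.1 j : ℤ)) 1 p.2 q.2 else 0)
    (hcard : Fintype.card κ + 2 * k ≤ k * n) :
    Fintype.card κ + 2 * k = k * n ∧
      ∀ a, monodromy ((List.range n).map (c a)) = -1 := by
  have hn0 : 0 < n := by omega
  let Φ : (Fin k × Fin n → ℚ) →ₗ[ℚ] (κ → ℚ) :=
    Matrix.mulVecLin (Matrix.of fun i p => (u p i : ℚ))
  have hrec : ∀ x ∈ LinearMap.ker Φ, ∀ a j,
      ∑ l, (gramOf n (fun j => -(c a j : ℤ)) 1 j l : ℚ) * x (a, l) = 0 := by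
    intro x hx a j
    have hx' : ∀ i, ∑ q, (u q i : ℚ) * x q = 0 := fun i => congrFun (LinearMap.mem_ker.1 hx) i
    have h1 : ∑ q, ((∑ i, u (a, j) i * u q i : ℤ) : ℚ) * x q = 0 := by
      push_cast
      simp only [Finset.sum_mul]
      rw [Finset.sum_comm]
      refine Finset.sum_eq_zero fun i _ => ?_
      simp only [mul_assoc]
      rw [← Finset.mul_sum, hx', mul_zero]
    simp only [hu] at h1
    rw [Fintype.sum_prod_type, Finset.sum_eq_single a] at h1
    · simpa using h1
    · intro b _ hb
      simp [hb.symm]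
    · simp
  let Ψ : (Fin k × Fin n → ℚ) →ₗ[ℚ] (Fin k → Fin 2 → ℚ) :=
    { toFun := fun x a => ![x (a, ⟨0, hn0⟩), -x (a, ⟨n - 1, by omega⟩)]
      map_add' := by
        intro x y
        ext a i
        fin_cases i <;> simp [add_comm]
      map_smul' := by
        intro r x
        ext a i
        fin_cases i <;> simp }
  let X : (Fin k × Fin n → ℚ) → Fin k → ℕ → ℚ := fun x a =>
    antiperiodicExtension hn0 fun l => x (a, l)
  have hX : ∀ x ∈ LinearMap.ker Φ, ∀ a, ∀ j < n,
      X x a (j + 2) = c a j * X x a (j + 1) - X x a j := fun x hx a =>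
    antiperiodicExtension_rec hn (c a) _ (hrec x hx a)
  have hinj : Function.Injective (Ψ.domRestrict (LinearMap.ker Φ)) := by
    rw [← LinearMap.ker_eq_bot, LinearMap.ker_eq_bot']
    rintro ⟨x, hx⟩ h0
    have h0' : ∀ a, X x a 1 = 0 ∧ X x a 0 = 0 := by
      intro a
      have e0 := congrFun (congrFun h0 a) 0
      have e1 := congrFun (congrFun h0 a) 1
      simp only [X, antiperiodicExtension, hn0, dif_pos]
      exact ⟨e0, e1⟩
    have hz : ∀ a, ∀ j ≤ n, X x a (j + 1) = 0 ∧ X x a j = 0 := by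
      intro a j
      induction j with
      | zero => exact fun _ => h0' a
      | succ j ih =>
        intro hj
        obtain ⟨h1, h2⟩ := ih (by omega)
        refine ⟨?_, h1⟩
        rw [hX x hx a j (by omega), h1, h2]
        simp
    ext ⟨a, l⟩
    have := (hz a l l.2.le).1
    simpa [X, antiperiodicExtension] using this
  have hdim := LinearMap.finrank_range_add_finrank_ker Φ
  have hrange : Module.finrank ℚ (LinearMap.range Φ) ≤ Fintype.card κ := by
    simpa using Submodule.finrank_le (LinearMap.range Φ)
  have hker := LinearMap.finrank_le_finrank_of_injective hinj
  simp only [Module.finrank_fintype_fun_eq_card, Fintype.card_prod, Fintype.card_fin,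
    Module.finrank_pi_fintype, Finset.sum_const, Finset.card_univ, smul_eq_mul] at hdim hker
  refine ⟨by omega, fun a => ?_⟩
  have hsurj : Function.Surjective (Ψ.domRestrict (LinearMap.ker Φ)) := by
    refine (LinearMap.injective_iff_surjective_of_finrank_eq_finrank ?_).1 hinj
    simp only [Module.finrank_fintype_fun_eq_card, Fintype.card_fin,
      Module.finrank_pi_fintype, Finset.sum_const, Finset.card_univ, smul_eq_mul]
    omega
  have hvec : ∀ v, Matrix.vecMul v (monodromy ((List.range n).map (c a))) = -v := by
    intro v
    obtain ⟨⟨x, hx⟩, hxv⟩ := hsurj fun _ => v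
    have e : ![X x a 1, X x a 0] = v := by
      rw [← congrFun hxv a]
      simp only [X, antiperiodicExtension, hn0, dif_pos]
      rfl
    have e' : ![X x a (n + 1), X x a n] = -v := by
      rw [← congrFun hxv a]
      obtain ⟨m, rfl⟩ := Nat.exists_eq_add_of_lt hn0
      ext i
      fin_cases i
      · simp [X, Ψ, antiperiodicExtension]
      · simp [X, Ψ, antiperiodicExtension]
    rw [← e', ← vecMul_monodromy (c a) (X x a) n (hX x hx a), e]
  ext i j
  have := congrFun (hvec (Pi.single i 1)) j
  rw [Matrix.single_one_vecMul] at this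
  simpa [Matrix.one_apply, Pi.single_apply, eq_comm] using this

theorem List.sum_map_range_eq (f : ℕ → ℕ) (n : ℕ) :
    ((List.range n).map f).sum = ∑ j ∈ Finset.range n, f j := by
  induction n with
  | zero => simp
  | succ n ih => simp [List.range_succ, Finset.sum_range_succ, ih]

theorem List.count_one_map_range (f : ℕ → ℕ) (n : ℕ) :
    ((List.range n).map f).count 1 = ∑ j ∈ Finset.range n, if f j = 1 then 1 else 0 := by
  induction n with
  | zero => simp
  | succ n ih =>
    rw [List.range_succ, Finset.sum_range_succ, ← ih]
    simp [List.count_singleton]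

theorem sum_blockEntry {t : ℕ} (x y : Fin t → ℕ) (hy : ∀ i, 1 ≤ y i) :
    ∑ j ∈ Finset.range (∑ i, y i), blockEntry x y j = ∑ i, x i + 2 * ∑ i, y i := by
  rw [← List.sum_map_range_eq, ← flatten_blocks x y hy, List.sum_flatten, List.map_ofFn,
    List.sum_ofFn, Finset.mul_sum, ← Finset.sum_add_distrib]
  refine Finset.sum_congr rfl fun i _ => ?_
  have := hy i
  simp only [Function.comp, List.sum_cons, List.sum_replicate, smul_eq_mul]
  omega

theorem exists_iteratedBlowup_of_le {n : ℕ} (hn : 3 ≤ n) (f g : ℕ → ℕ)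
    (hg : ∀ j, 2 ≤ g j) (hfg : ∀ j < n, f j ≤ g j)
    (hmono : TrivialMonodromy ((List.range n).map f))
    (hf_sum : ∑ j ∈ Finset.range n, f j + 6 = 3 * n)
    (hg_sum : ∑ j ∈ Finset.range n, g j + 4 = 3 * n) :
    ∃ s : List ℕ, IsIteratedBlowup s ∧ s.count 1 = 2 ∧
      (List.range n).map g = s.map fun a => if a = 1 then 2 else a := by
  have hsum : ((List.range n).map f).sum + 6 = 3 * ((List.range n).map f).length := by
    simpa [List.sum_map_range_eq] using hf_sum
  have hlen : 3 ≤ ((List.range n).map f).length := by simpa using hn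
  have hpos : ∀ a ∈ (List.range n).map f, 1 ≤ a := fun a ha =>
    Nat.one_le_iff_ne_zero.2 fun h => hmono.zero_notMem hlen hsum (h ▸ ha)
  have hcount := two_le_count_one (List.ne_nil_of_length_pos (by omega)) hmono hpos
  have hle : ∀ j ∈ Finset.range n, f j + (if f j = 1 then 1 else 0) ≤ g j := by
    intro j hj
    have h1 := hfg j (Finset.mem_range.1 hj)
    have h2 := hg j
    split_ifs <;> omega
  have hle_sum := Finset.sum_le_sum hle
  rw [Finset.sum_add_distrib, ← List.count_one_map_range] at hle_sum
  have hcount_eq : ((List.range n).map f).count 1 = 2 := by omega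
  have heq := (Finset.sum_eq_sum_iff_of_le hle).1 (by
    rw [Finset.sum_add_distrib, ← List.count_one_map_range]
    omega)
  refine ⟨_, (hmono.sum_le (by omega)).2 hsum, hcount_eq, ?_⟩
  rw [List.map_map]
  refine List.map_congr_left fun j hj => ?_
  have := heq j (by simpa using hj)
  simp only [Function.comp]
  split_ifs at this ⊢ <;> omega

/-- If `Λ_Γ^k` (with `d = 1`, `∑ yᵢ = ∑ xᵢ + 4 ≥ 6`) embeds
isometrically with finite and odd index in `ℤ^N`, `N = k ∑ yᵢ`, then the string
`(x₁+2, 2^{y₁-1}, …, xₜ+2, 2^{yₜ-1})` is obtained from an iterated blowup of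
`(0,0)` containing exactly two `1`'s by replacing those two `1`'s with `2`'s. -/
theorem stmt_0 (t : ℕ) (ht : 1 ≤ t) (x y : Fin t → ℕ)
    (hx : ∀ i, 1 ≤ x i) (hy : ∀ i, 1 ≤ y i)
    (hsum : ∑ i, y i = (∑ i, x i) + 4) (h6 : 6 ≤ ∑ i, y i)
    (n : ℕ) (hn : n = ∑ i, y i)
    (k : ℕ) (hk : 1 ≤ k) (N : ℕ) (hN : N = k * n)
    (ι : Fin k → Fin n → (Fin N → ℤ))
    (hgram : ∀ a b : Fin k, ∀ j l : Fin n,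
      negForm N (ι a j) (ι b l) =
        if a = b then gramOf n (sqOf x y n) 1 j l else 0)
    (hinj : LinearIndependent ℤ (fun p : Fin k × Fin n => ι p.1 p.2))
    (hodd : Odd (AddSubgroup.closure
      (Set.range fun p : Fin k × Fin n => ι p.1 p.2)).index) :
    ∃ s : List ℕ, IsIteratedBlowup s ∧ s.count 1 = 2 ∧
      (List.ofFn fun i : Fin t =>
        (x i + 2) :: List.replicate (y i - 1) 2).flatten =
        s.map fun a => if a = 1 then 2 else a := by
  classical
  have hn3 : 3 ≤ n := by omega
  set w : Fin k × Fin n → Fin N → ℤ := fun p => ι p.1 p.2 with hw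
  have hdot : ∀ p q, ∑ i, w p i * w q i =
      if p.1 = q.1 then -gramOf n (sqOf x y n) 1 p.2 q.2 else 0 := by
    intro p q
    have h := hgram p.1 q.1 p.2 q.2
    simp only [negForm] at h
    rw [neg_eq_iff_eq_neg] at h
    simp only [hw]
    rw [h]
    split_ifs <;> simp
  have hsq : ∀ p, ∑ i, w p i ^ 2 = blockEntry x y p.2 := by
    intro p
    simp only [sq, hdot, if_true, gramOf, sqOf_eq, neg_neg]
  have hrow : ∀ p, Even (∑ q, ∑ i, w p i * w q i + ∑ i, w p i ^ 2) := by
    rintro ⟨a, j⟩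
    rw [hsq]
    simp only [hdot]
    rw [Fintype.sum_prod_type, Finset.sum_eq_single a (fun b _ hb => by simp [hb.symm]) (by simp)]
    have h := (even_sum_gramOf_sub hn3 (sqOf x y n) j).neg
    rw [sqOf_eq] at h
    simp only [if_true, Finset.sum_neg_distrib]
    have e : -∑ l, gramOf n (sqOf x y n) 1 j l + (blockEntry x y j : ℤ) =
        -(∑ l, gramOf n (sqOf x y n) 1 j l - -(blockEntry x y j : ℤ)) +
          2 * (blockEntry x y j : ℤ) := by ring
    rw [e]
    exact h.add (even_two_mul _)
  have hcol := odd_column_sum w hrow hodd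
  set P := privateCoords w
  have hg_sum : ∑ j ∈ Finset.range n, blockEntry x y j + 4 = 3 * n := by
    rw [hn, sum_blockEntry x y hy]
    omega
  have henergy : ∑ p, ∑ i, w p i ^ 2 = (k : ℤ) * (3 * n - 4) := by
    simp only [hsq]
    rw [Fintype.sum_prod_type]
    simp only [Finset.sum_const, Finset.card_univ, Fintype.card_fin, nsmul_eq_mul]
    rw [Fin.sum_univ_eq_sum_range (fun j => (blockEntry x y j : ℤ)) n]
    congr 1
    rw [eq_sub_iff_add_eq]
    exact_mod_cast hg_sum
  have hPcard : 2 * k ≤ P.card := by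
    have h := le_energy_add_card_privateCoords w hcol
    have hNk : (N : ℤ) = k * n := by exact_mod_cast hN
    rw [henergy, hNk] at h
    zify
    linarith
  have hPN : Fintype.card (Pᶜ : Finset (Fin N)) + P.card = k * n := by
    rw [Fintype.card_coe, Finset.card_compl, Fintype.card_fin, ← hN]
    have := P.card_le_univ
    rw [Fintype.card_fin] at this
    omega
  let c : Fin k → ℕ → ℕ := fun a j =>
    if h : j < n then (∑ i ∈ Pᶜ, w (a, ⟨j, h⟩) i ^ 2).toNat else 0
  have hc : ∀ a (j : Fin n), (c a j : ℤ) = ∑ i ∈ Pᶜ, w (a, j) i ^ 2 := by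
    intro a j
    simp only [c, j.2, dif_pos]
    exact Int.toNat_of_nonneg (Finset.sum_nonneg fun _ _ => sq_nonneg _)
  have hdot' : ∀ p q, ∑ i : (Pᶜ : Finset (Fin N)), w p i * w q i =
      if p.1 = q.1 then -gramOf n (fun j => -(c p.1 j : ℤ)) 1 p.2 q.2 else 0 := by
    intro p q
    rw [Finset.sum_coe_sort Pᶜ fun i => w p i * w q i]
    by_cases hpq : p = q
    · subst hpq
      simp [gramOf, hc, sq]
    · have h0 : ∑ i ∈ P, w p i * w q i = 0 := Finset.sum_eq_zero fun i hi =>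
        mul_eq_zero_of_mem_privateCoords hi hpq
      have h1 := Finset.sum_add_sum_compl P fun i => w p i * w q i
      rw [h0, zero_add, hdot] at h1
      rw [h1]
      split_ifs with hpq1
      · have hpq2 : p.2 ≠ q.2 := fun h => hpq (Prod.ext hpq1 h)
        simp [gramOf, hpq2]
      · rfl
  obtain ⟨hcard, hmono⟩ := monodromy_eq_neg_one hn3
    (fun p (i : (Pᶜ : Finset (Fin N))) => w p i) c hdot' (by omega)
  have hf_total : ∑ a, ∑ j ∈ Finset.range n, c a j + 6 * k = 3 * n * k := by
    have h1 : ((∑ a, ∑ j ∈ Finset.range n, c a j : ℕ) : ℤ) = ∑ p, ∑ i ∈ Pᶜ, w p i ^ 2 := by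
      push_cast
      rw [Fintype.sum_prod_type]
      refine Finset.sum_congr rfl fun a _ => ?_
      rw [← Fin.sum_univ_eq_sum_range (fun j => (c a j : ℤ)) n]
      exact Finset.sum_congr rfl fun j _ => hc a j
    have h2 : ∑ p, ∑ i ∈ P, w p i ^ 2 = (P.card : ℤ) := by
      have h : ∀ i ∈ P, ∑ p, w p i ^ 2 = 1 := fun i hi => (Finset.mem_filter.1 hi).2
      rw [Finset.sum_comm, Finset.sum_congr rfl h]
      simp
    have h3 : ∑ p, ∑ i ∈ P, w p i ^ 2 + ∑ p, ∑ i ∈ Pᶜ, w p i ^ 2 = (k : ℤ) * (3 * n - 4) := by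
      rw [← henergy, ← Finset.sum_add_distrib]
      exact Finset.sum_congr rfl fun p _ => Finset.sum_add_sum_compl P _
    have h4 : P.card = 2 * k := by omega
    rw [h2, ← h1, h4] at h3
    zify
    push_cast at h3
    linarith
  have hle : ∀ a ∈ (Finset.univ : Finset (Fin k)),
      ∑ j ∈ Finset.range n, c a j + 6 ≤ 3 * n := by
    intro a _
    have h := (TrivialMonodromy.sum_le (l := (List.range n).map (c a))
      (by simp; omega) (Or.inr (hmono a))).1
    simpa [List.sum_map_range_eq] using h
  have hf_sum := (Finset.sum_eq_sum_iff_of_le hle).1 (by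
    rw [Finset.sum_add_distrib]
    simp only [Finset.sum_const, Finset.card_univ, Fintype.card_fin, smul_eq_mul]
    linarith) ⟨0, hk⟩ (Finset.mem_univ _)
  rw [flatten_blocks x y hy, ← hn]
  refine exists_iteratedBlowup_of_le hn3 (c ⟨0, hk⟩) (blockEntry x y)
    (fun j => Nat.le_add_right _ _) ?_ (Or.inr (hmono _)) hf_sum hg_sum
  intro j hj
  zify
  rw [hc _ ⟨j, hj⟩, ← hsq (⟨0, hk⟩, ⟨j, hj⟩)]
  exact Finset.sum_le_sum_of_subset_of_nonneg (Finset.subset_univ _) fun _ _ _ => sq_nonneg _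
end

section
/- Let V ⊂ Z^N be a semipositive circular subset such that: Λ_V ⊂ Z^N has finite and odd index; its Wu element W = ∑_{v∈V} v satisfies W·W = -N; v·v ≤ -2 for each v ∈ V; and every connected component D of V satisfies ∑_{v∈D}(v·v+2) = 4 − |D| < -1. Then for every connected component C of V, with string of self-intersections (-c_1,…,-c_{|C|}), there exists an iterated blowup (s_1,…,s_{|C|}) of (0,0) containing exactly two entries equal to 1, such that c_i ≥ s_i for every i = 1,…,|C|. -/
open Finset

section CyclicGram

variable {ι : Type*} [Fintype ι]

/-- The cyclic Gram conditions on `w 0, …, w (m - 1)`: consecutive vectors pair to `-1`, the first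
and the last one pair to `1`, and all other pairs are orthogonal. -/
structure IsCyclicGram (m : ℕ) (w : ℕ → ι → ℤ) : Prop where
  succ : ∀ i, i + 1 < m → w i ⬝ᵥ w (i + 1) = -1
  ends : ∀ i, i + 1 = m → w 0 ⬝ᵥ w i = 1
  ortho : ∀ i j, i + 2 ≤ j → j < m → ¬ (i = 0 ∧ j + 1 = m) → w i ⬝ᵥ w j = 0

/-- For every index `j < m` there is a nontrivial linear relation between
`w 0, …, w (m - 1)` in which `w j` does not occur. -/
def HasRelations (m : ℕ) (w : ℕ → ι → ℤ) : Prop :=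
  ∀ j < m, ∃ a : ℕ → ℤ, a j = 0 ∧ (∃ k < m, a k ≠ 0) ∧ ∑ i ∈ range m, a i • w i = 0

/-- Deleting the vector `w (p + 1)` from a sequence after projecting along it. -/
def contractSeq (w : ℕ → ι → ℤ) (p j : ℕ) : ι → ℤ :=
  let x := w (if j ≤ p then j else j + 1)
  x - (x ⬝ᵥ w (p + 1)) • w (p + 1)

lemma dotProduct_self_pos_of_ne {u v : ι → ℤ} (h : u ⬝ᵥ v ≠ 0) : 0 < u ⬝ᵥ u := by
  have h0 : 0 ≤ u ⬝ᵥ u := Finset.sum_nonneg fun i _ => mul_self_nonneg _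
  refine lt_of_le_of_ne h0 fun h1 => h ?_
  rw [eq_comm, dotProduct_self_eq_zero] at h1
  simp [h1]

namespace IsCyclicGram

variable {m p q : ℕ} {w : ℕ → ι → ℤ} {a : ℕ → ℤ}

lemma self_pos (hw : IsCyclicGram m w) {i : ℕ} (hi : i < m) : 0 < w i ⬝ᵥ w i := by
  by_cases h : i + 1 < m
  · exact dotProduct_self_pos_of_ne (v := w (i + 1)) (by rw [hw.succ i h]; norm_num)
  · refine dotProduct_self_pos_of_ne (v := w 0) ?_
    rw [dotProduct_comm, hw.ends i (by omega)]; norm_num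

lemma relation_interior (hw : IsCyclicGram (p + 3 + q) w)
    (ha : ∑ i ∈ range (p + 3 + q), a i • w i = 0) :
    a (p + 1) * (w (p + 1) ⬝ᵥ w (p + 1)) = a p + a (p + 2) := by
  have h := congrArg (w (p + 1) ⬝ᵥ ·) ha
  simp only [dotProduct_sum, dotProduct_zero, dotProduct_smul, smul_eq_mul] at h
  rw [sum_range_add, sum_range_succ, sum_range_succ, sum_range_succ, sum_eq_zero, sum_eq_zero,
    dotProduct_comm _ (w p), hw.succ p (by omega), hw.succ (p + 1) (by omega)] at h
  · linarith
  · intro i _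
    rw [hw.ortho _ _ (by omega) (by simp_all) (by omega), mul_zero]
  · intro i hi
    rw [mem_range] at hi
    rw [dotProduct_comm, hw.ortho _ _ (by omega) (by omega) (by omega), mul_zero]

lemma relation_last (hw : IsCyclicGram (p + 3) w)
    (ha : ∑ i ∈ range (p + 3), a i • w i = 0) :
    a (p + 2) * (w (p + 2) ⬝ᵥ w (p + 2)) = a (p + 1) - a 0 := by
  have h := congrArg (w (p + 2) ⬝ᵥ ·) ha
  simp only [dotProduct_sum, dotProduct_zero, dotProduct_smul, smul_eq_mul] at h
  rw [sum_range_succ, sum_range_succ, sum_range_succ', sum_eq_zero, dotProduct_comm _ (w 0),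
    hw.ends _ rfl, dotProduct_comm _ (w (p + 1)), hw.succ (p + 1) (by omega)] at h
  · linarith
  · intro i hi
    rw [mem_range] at hi
    rw [dotProduct_comm, hw.ortho _ _ (by omega) (by omega) (by omega), mul_zero]

/-- A relation between vectors with cyclic Gram conditions forces a vector of square one. -/
lemma exists_self_eq_one (hw : IsCyclicGram m w) (hm : 3 ≤ m) (hr : HasRelations m w) :
    ∃ p q, m = p + 3 + q ∧ w (p + 1) ⬝ᵥ w (p + 1) = 1 := by
  classical
  obtain ⟨a, ha0, ⟨k, hk, hak⟩, ha⟩ := hr 0 (by omega)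
  have hex : ∃ j, j < m ∧ ∀ k < m, |a k| ≤ |a j| := by
    obtain ⟨j, hj, h⟩ := exists_max_image (range m) (fun j => |a j|) ⟨0, by simp; omega⟩
    exact ⟨j, by simpa using hj, fun k hk => h k (by simpa using hk)⟩
  obtain ⟨hi, hmax⟩ := Nat.find_spec hex
  have hfirst : ∀ j < Nat.find hex, |a j| < |a (Nat.find hex)| := by
    intro j hj
    have := Nat.find_min hex hj
    push Not at this
    obtain ⟨l, hl, hlt⟩ := this (by omega)
    exact hlt.trans_le (hmax l hl)
  generalize Nat.find hex = i at *
  have hai : 0 < |a i| := (abs_pos.2 hak).trans_le (hmax k hk)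
  obtain ⟨p, rfl⟩ : ∃ p, i = p + 1 := ⟨i - 1, by
    rcases i with _ | i
    · simp [ha0] at hai
    · rfl⟩
  have hc := hw.self_pos hi
  have hp := hfirst p (by omega)
  by_cases hlast : p + 2 = m
  · obtain ⟨r, rfl⟩ : ∃ r, p = r + 1 := ⟨p - 1, by omega⟩
    subst hlast
    have h := hw.relation_last ha
    rw [ha0, sub_zero] at h
    rw [← h, abs_mul, abs_of_pos hc] at hp
    nlinarith
  · obtain ⟨q, rfl⟩ : ∃ q, m = p + 3 + q := ⟨m - (p + 3), by omega⟩
    refine ⟨p, q, rfl, ?_⟩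
    have h := congrArg abs (hw.relation_interior ha)
    rw [abs_mul, abs_of_pos hc] at h
    have h2 := hmax (p + 2) (by omega)
    have h3 := abs_add_le (a p) (a (p + 2))
    nlinarith

lemma dotProduct_eq (hw : IsCyclicGram (p + 3 + q) w) {i : ℕ} (hi : i < p + 3 + q)
    (hip : i ≠ p + 1) : w i ⬝ᵥ w (p + 1) = if i = p ∨ i = p + 2 then -1 else 0 := by
  rcases lt_or_gt_of_ne hip with h | h
  · split_ifs with h2
    · obtain rfl : i = p := by omega
      exact hw.succ i (by omega)
    · exact hw.ortho _ _ (by omega) (by omega) (by omega)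
  · rw [dotProduct_comm]
    split_ifs with h2
    · obtain rfl : i = p + 2 := by omega
      exact hw.succ _ (by omega)
    · exact hw.ortho _ _ (by omega) (by omega) (by omega)

lemma contractSeq_dotProduct (hw : IsCyclicGram (p + 3 + q) w)
    (h1 : w (p + 1) ⬝ᵥ w (p + 1) = 1) {i j : ℕ} (hi : i + 1 < p + 3 + q)
    (hj : j + 1 < p + 3 + q) :
    contractSeq w p i ⬝ᵥ contractSeq w p j =
      w (if i ≤ p then i else i + 1) ⬝ᵥ w (if j ≤ p then j else j + 1) -
        if (i = p ∨ i = p + 1) ∧ (j = p ∨ j = p + 1) then 1 else 0 := by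
  have h : ∀ i, i + 1 < p + 3 + q → w (if i ≤ p then i else i + 1) ⬝ᵥ w (p + 1) =
      if i = p ∨ i = p + 1 then -1 else 0 := by
    intro i hi
    rw [hw.dotProduct_eq (by split_ifs <;> omega) (by split_ifs <;> omega)]
    grind
  simp only [contractSeq, sub_dotProduct, dotProduct_sub, smul_dotProduct, dotProduct_smul,
    smul_eq_mul, h1, dotProduct_comm (w (p + 1)), h i hi, h j hj]
  grind

lemma contract (hw : IsCyclicGram (p + 3 + q) w) (hpq : 1 ≤ p + q) (h1 : w (p + 1) ⬝ᵥ w (p + 1) = 1) :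
    IsCyclicGram (p + 2 + q) (contractSeq w p) where
  succ i hi := by
    rw [hw.contractSeq_dotProduct h1 (by omega) (by omega)]
    rcases lt_trichotomy i p with h | rfl | h
    · rw [if_pos h.le, if_pos (by omega), if_neg (by omega), hw.succ i (by omega), sub_zero]
    · rw [if_pos le_rfl, if_neg (by omega), if_pos (by omega),
        hw.ortho i (i + 1 + 1) (by omega) (by omega) (by omega)]
      norm_num
    · rw [if_neg (show ¬ i ≤ p by omega), if_neg (show ¬ i + 1 ≤ p by omega),
        hw.succ (i + 1) (by omega)]
      grind
  ends i hi := by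
    rw [hw.contractSeq_dotProduct h1 (by omega) (by omega), if_pos (by omega), if_neg (by omega),
      hw.ends _ (by omega), if_neg (by omega), sub_zero]
  ortho i j hij hj hn := by
    rw [hw.contractSeq_dotProduct h1 (by omega) (by omega),
      if_neg (c := (i = p ∨ i = p + 1) ∧ (j = p ∨ j = p + 1)) (by omega), sub_zero]
    exact hw.ortho _ _ (by split_ifs <;> omega) (by split_ifs <;> omega) (by grind)

end IsCyclicGram

lemma sum_range_eq_add_skip {M : Type*} [AddCommMonoid M] (f : ℕ → M) (p q : ℕ) :
    ∑ j ∈ range (p + 3 + q), f j =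
      f (p + 1) + ∑ j ∈ range (p + 2 + q), f (if j ≤ p then j else j + 1) := by
  rw [show p + 3 + q = p + 1 + (q + 1 + 1) by omega,
    show p + 2 + q = p + 1 + (q + 1) by omega, sum_range_add, sum_range_add _ (p + 1) (q + 1),
    sum_range_succ' _ (q + 1), add_zero, ← add_assoc, add_comm (f (p + 1))]
  congr 2
  · exact sum_congr rfl fun j hj => by rw [if_pos (by simp at hj; omega)]
  · exact sum_congr rfl fun j hj => by rw [if_neg (by omega)]; rfl

lemma HasRelations.contract {p q : ℕ} {w : ℕ → ι → ℤ} (hr : HasRelations (p + 3 + q) w)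
    (h1 : w (p + 1) ⬝ᵥ w (p + 1) = 1) : HasRelations (p + 2 + q) (contractSeq w p) := by
  intro j hj
  obtain ⟨a, haj, ⟨k, hk, hak⟩, ha⟩ := hr (if j ≤ p then j else j + 1) (by split_ifs <;> omega)
  refine ⟨fun j => a (if j ≤ p then j else j + 1), haj, ?_, ?_⟩
  · by_contra! hcon
    have h0 : ∀ k < p + 3 + q, k ≠ p + 1 → a k = 0 := by
      intro k hk hkp
      rcases lt_or_gt_of_ne hkp with h | h
      · simpa [Nat.lt_succ_iff.1 h] using hcon k (by omega)
      · have := hcon (k - 1) (by omega)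
        rwa [if_neg (by omega), Nat.sub_add_cancel (by omega)] at this
    rw [sum_range_eq_add_skip, sum_eq_zero, add_zero] at ha
    · obtain rfl : k = p + 1 := by by_contra h; exact hak (h0 k hk h)
      rcases smul_eq_zero.1 ha with h | h
      · exact hak h
      · simp [h] at h1
    · intro i hi
      rw [mem_range] at hi
      rw [h0 _ (by split_ifs <;> omega) (by split_ifs <;> omega), zero_smul]
  · have h : ∑ j ∈ range (p + 3 + q),
        a j • (w j - (w j ⬝ᵥ w (p + 1)) • w (p + 1)) = 0 := by
      have h2 := congrArg (· ⬝ᵥ w (p + 1)) ha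
      simp only [sum_dotProduct, zero_dotProduct, smul_dotProduct] at h2
      simp only [smul_sub, sum_sub_distrib, ha, ← smul_assoc, ← sum_smul, h2, zero_smul, sub_zero]
    rw [sum_range_eq_add_skip, h1, one_smul, sub_self, smul_zero, zero_add] at h
    exact h

lemma isIteratedBlowup_three : IsIteratedBlowup [1, 1, 1] :=
  .single (.middle 0 0 [] [])

lemma isBlowup_map_range {c c' : ℕ → ℕ} {p q : ℕ} (hlt : ∀ j < p, c j = c' j)
    (h0 : c p = c' p + 1) (h1 : c (p + 1) = 1) (h2 : c (p + 2) = c' (p + 1) + 1)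
    (hgt : ∀ j, p + 1 < j → j < p + 2 + q → c (j + 1) = c' j) :
    IsBlowup ((List.range (p + 2 + q)).map c') ((List.range (p + 3 + q)).map c) := by
  have h : (List.range p).map c = (List.range p).map c' :=
    List.map_congr_left fun j hj => hlt j (List.mem_range.1 hj)
  have h' : (List.range q).map (fun j => c (p + 3 + j)) =
      (List.range q).map fun j => c' (p + 2 + j) :=
    List.map_congr_left fun j hj => by
      rw [List.mem_range] at hj; rw [← hgt _ (by omega) (by omega)]; congr 1; omega
  have := IsBlowup.middle (c' p) (c' (p + 1)) ((List.range p).map c')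
    ((List.range q).map fun j => c' (p + 2 + j))
  convert this using 1
  · simp [List.range_add, List.range_succ, Function.comp_def]
  · rw [← h', ← h0, ← h2, ← h]
    simp [h1, List.range_add, List.range_succ, Function.comp_def]

/-- A Conway-Coxeter type theorem: the squares of a sequence of vectors with cyclic Gram conditions
and relations form an iterated blowup of `(0, 0)`. -/
theorem IsCyclicGram.isIteratedBlowup (n : ℕ) : ∀ w : ℕ → ι → ℤ, IsCyclicGram (n + 3) w →
    HasRelations (n + 3) w →
    IsIteratedBlowup ((List.range (n + 3)).map fun i => (w i ⬝ᵥ w i).toNat) := by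
  induction n with
  | zero =>
    intro w hw hr
    have h01 := hw.succ 0 (by omega)
    have h12 := hw.succ 1 (by omega)
    have h02 := hw.ends 2 rfl
    have p0 := hw.self_pos (i := 0) (by omega)
    have p1 := hw.self_pos (i := 1) (by omega)
    have p2 := hw.self_pos (i := 2) (by omega)
    have key : ∀ u v : ι → ℤ, ∀ a b : ℤ, (a ≠ 0 ∨ b ≠ 0) → a • u + b • v = 0 →
        (u ⬝ᵥ v) ^ 2 = 1 → (u ⬝ᵥ u) * (v ⬝ᵥ v) = 1 := by
      intro u v a b hab h huv
      have hu := congrArg (· ⬝ᵥ u) h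
      have hv := congrArg (· ⬝ᵥ v) h
      simp only [add_dotProduct, smul_dotProduct, zero_dotProduct, smul_eq_mul,
        dotProduct_comm v u] at hu hv
      have ea : a * ((u ⬝ᵥ u) * (v ⬝ᵥ v) - 1) = 0 := by
        linear_combination (v ⬝ᵥ v) * hu - (u ⬝ᵥ v) * hv + a * huv
      have eb : b * ((u ⬝ᵥ u) * (v ⬝ᵥ v) - 1) = 0 := by
        linear_combination (u ⬝ᵥ u) * hv - (u ⬝ᵥ v) * hu + b * huv
      rcases hab with h | h
      · linarith [(mul_eq_zero.1 ea).resolve_left h]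
      · linarith [(mul_eq_zero.1 eb).resolve_left h]
    obtain ⟨a, ha0, ⟨k, hk, hak⟩, ha⟩ := hr 0 (by omega)
    obtain ⟨b, hb0, ⟨l, hl, hbl⟩, hb⟩ := hr 1 (by omega)
    simp only [sum_range_succ, range_zero, sum_empty, ha0, hb0, zero_smul, zero_add,
      add_zero] at ha hb
    have e12 := key _ _ _ _ (by interval_cases k <;> simp_all) ha (by rw [h12]; norm_num)
    have e02 := key _ _ _ _ (by interval_cases l <;> simp_all) hb (by rw [h02]; norm_num)
    have q2 : w 2 ⬝ᵥ w 2 = 1 := by nlinarith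
    have q1 : w 1 ⬝ᵥ w 1 = 1 := by rwa [q2, mul_one] at e12
    have q0 : w 0 ⬝ᵥ w 0 = 1 := by rwa [q2, mul_one] at e02
    simpa [List.range_succ, q0, q1, q2] using isIteratedBlowup_three
  | succ n ih =>
    intro w hw hr
    obtain ⟨p, q, hm, h1⟩ := hw.exists_self_eq_one (by omega) hr
    rw [hm] at hw hr ⊢
    have hn : n + 3 = p + 2 + q := by omega
    have hI := ih (contractSeq w p) (by rw [hn]; exact hw.contract (by omega) h1)
      (by rw [hn]; exact hr.contract h1)
    rw [hn] at hI
    have hd : ∀ j, j + 1 < p + 3 + q → _ := fun j hj => hw.contractSeq_dotProduct h1 hj hj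
    have hpos : ∀ j, 0 ≤ contractSeq w p j ⬝ᵥ contractSeq w p j := fun j =>
      Finset.sum_nonneg fun i _ => mul_self_nonneg _
    refine hI.tail (isBlowup_map_range (fun j hj => ?_) ?_ ?_ ?_ fun j hj hjq => ?_)
    · rw [hd j (by omega)]
      grind
    · have := hd p (by omega)
      simp only [true_or, and_self, if_true, le_refl] at this
      have := hpos p
      grind
    · simp [h1]
    · have := hd (p + 1) (by omega)
      have := hpos (p + 1)
      grind
    · rw [hd j (by omega)]
      grind

end CyclicGram

section TwoRegular

variable {α ι : Type*} [Fintype ι]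

/-- In the family `P v`, `v ∈ V`, of integral vectors, every vector pairs to `±1` with exactly two
others and is orthogonal to the rest. -/
def IsTwoRegular (P : α → ι → ℤ) (V : Finset α) : Prop :=
  ∀ v ∈ V, ∃ x ∈ V, ∃ y ∈ V, x ≠ v ∧ y ≠ v ∧ x ≠ y ∧ (P v ⬝ᵥ P x) ^ 2 = 1 ∧
    (P v ⬝ᵥ P y) ^ 2 = 1 ∧ ∀ u ∈ V, u ≠ v → P v ⬝ᵥ P u ≠ 0 → u = x ∨ u = y

/-- Adjacency of distinct members of a family of vectors. -/
def Adjacent (P : α → ι → ℤ) (V : Finset α) (u v : α) : Prop :=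
  u ∈ V ∧ v ∈ V ∧ u ≠ v ∧ P u ⬝ᵥ P v ≠ 0

variable {P : α → ι → ℤ} {V : Finset α} {a : α → ℤ}

lemma Adjacent.symm {u v : α} (h : Adjacent P V u v) : Adjacent P V v u :=
  ⟨h.2.1, h.1, h.2.2.1.symm, by rw [dotProduct_comm]; exact h.2.2.2⟩

lemma Adjacent.iff_of_forall {p : α → Prop} (hp : ∀ u v, Adjacent P V u v → p u → p v) {u v : α}
    (h : Relation.EqvGen (Adjacent P V) u v) : p u ↔ p v := by
  induction h with
  | rel u v h => exact ⟨hp u v h, hp v u h.symm⟩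
  | refl u => rfl
  | symm u v _ ih => exact ih.symm
  | trans u v w _ _ ih₁ ih₂ => exact ih₁.trans ih₂

namespace IsTwoRegular

lemma relation (ha : ∑ u ∈ V, a u • P u = 0) {v x y : α} (hv : v ∈ V) (hx : x ∈ V) (hy : y ∈ V)
    (hxv : x ≠ v) (hyv : y ≠ v) (hxy : x ≠ y)
    (h : ∀ u ∈ V, u ≠ v → P v ⬝ᵥ P u ≠ 0 → u = x ∨ u = y) :
    a v * (P v ⬝ᵥ P v) + a x * (P v ⬝ᵥ P x) + a y * (P v ⬝ᵥ P y) = 0 := by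
  classical
  have h1 := congrArg (P v ⬝ᵥ ·) ha
  simp only [dotProduct_sum, dotProduct_zero, dotProduct_smul, smul_eq_mul] at h1
  have hsub : ({v, x, y} : Finset α) ⊆ V := by
    intro u hu
    simp only [mem_insert, mem_singleton] at hu
    rcases hu with rfl | rfl | rfl <;> assumption
  rw [← sum_subset hsub, sum_insert (by simp [hxv.symm, hyv.symm]), sum_insert (by simpa using hxy),
    sum_singleton] at h1
  · linarith
  · intro u hu hu'
    simp only [mem_insert, mem_singleton, not_or] at hu'
    by_contra hne
    rcases h u hu hu'.1 (fun h0 => hne (by rw [h0, mul_zero])) with h2 | h2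
    · exact hu'.2.1 h2
    · exact hu'.2.2 h2

/-- A relation vanishing at two adjacent vertices vanishes on their component. -/
lemma eq_zero_of_adjacent (hV : IsTwoRegular P V) (ha : ∑ u ∈ V, a u • P u = 0) {v x : α}
    (hvx : Adjacent P V v x) (hv : a v = 0) (hx : a x = 0) {u : α}
    (hu : Relation.EqvGen (Adjacent P V) v u) : a u = 0 := by
  have key : ∀ v x, Adjacent P V v x → a v = 0 → a x = 0 → ∀ z, Adjacent P V v z → a z = 0 := by
    rintro v x ⟨hvV, hxV, hvx, hne⟩ hv hx z ⟨-, hzV, hvz, hne'⟩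
    obtain ⟨s, hs, t, ht, hsv, htv, hst, hs1, ht1, hall⟩ := hV v hvV
    have h := relation ha hvV hs ht hsv htv hst hall
    have hs0 : P v ⬝ᵥ P s ≠ 0 := fun h0 => by simp [h0] at hs1
    have ht0 : P v ⬝ᵥ P t ≠ 0 := fun h0 => by simp [h0] at ht1
    rcases hall x hxV hvx.symm hne with rfl | rfl <;>
      rcases hall z hzV hvz.symm hne' with rfl | rfl <;> simp_all
  refine ((Adjacent.iff_of_forall (p := fun v => a v = 0 ∧ ∀ z, Adjacent P V v z → a z = 0)
    ?_ hu).1 ⟨hv, key v x hvx hv hx⟩).1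
  rintro u w huw ⟨hu0, hu1⟩
  exact ⟨hu1 w huw, key w u huw.symm (hu1 w huw) hu0⟩

/-- Maximum principle: a relation whose support consists of vectors of square at least two vanishes
on every component on which it has a zero. -/
lemma eq_zero_of_two_le (hV : IsTwoRegular P V) (ha : ∑ u ∈ V, a u • P u = 0)
    (h2 : ∀ u ∈ V, a u ≠ 0 → 2 ≤ P u ⬝ᵥ P u) {z : α} (hzV : z ∈ V) (hz : a z = 0) {u : α}
    (hu : u ∈ V) (huz : Relation.EqvGen (Adjacent P V) z u) : a u = 0 := by
  classical
  obtain ⟨t, ht, hmax⟩ := exists_max_image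
    (V.filter fun u => Relation.EqvGen (Adjacent P V) z u) (fun u => |a u|)
    ⟨z, by simp [hzV, Relation.EqvGen.refl z]⟩
  simp only [mem_filter, and_imp] at ht hmax
  obtain ⟨htV, hzt⟩ := ht
  suffices |a t| = 0 from by simpa [this] using hmax u hu huz
  suffices h : ∀ v w, Adjacent P V v w →
      (Relation.EqvGen (Adjacent P V) z v ∧ |a v| = |a t|) →
      (Relation.EqvGen (Adjacent P V) z w ∧ |a w| = |a t|) by
    rw [← ((Adjacent.iff_of_forall h hzt).2 ⟨hzt, rfl⟩).2, hz, abs_zero]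
  rintro v w hvw ⟨hzv, hv⟩
  have hzw := hzv.trans _ _ _ (.rel _ _ hvw)
  refine ⟨hzw, ?_⟩
  obtain ⟨hvV, hwV, hne, hd⟩ := hvw
  by_cases hv0 : a v = 0
  · have := hmax w hwV hzw
    rw [← hv, hv0, abs_zero] at this ⊢
    exact le_antisymm this (abs_nonneg _)
  obtain ⟨x, hx, y, hy, hxv, hyv, hxy, hx1, hy1, hall⟩ := hV v hvV
  have h := relation ha hvV hx hy hxv hyv hxy hall
  have hvx : Adjacent P V v x := ⟨hvV, hx, hxv.symm, fun h0 => by simp [h0] at hx1⟩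
  have hvy : Adjacent P V v y := ⟨hvV, hy, hyv.symm, fun h0 => by simp [h0] at hy1⟩
  have hmx := hmax x hx (hzv.trans _ _ _ (.rel _ _ hvx))
  have hmy := hmax y hy (hzv.trans _ _ _ (.rel _ _ hvy))
  have h2v := h2 v hvV hv0
  have hax : |P v ⬝ᵥ P x| = 1 := by
    simpa using (sq_eq_sq_iff_abs_eq_abs _ 1).1 (hx1.trans (one_pow 2).symm)
  have hay : |P v ⬝ᵥ P y| = 1 := by
    simpa using (sq_eq_sq_iff_abs_eq_abs _ 1).1 (hy1.trans (one_pow 2).symm)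
  have habs : |a v| * (P v ⬝ᵥ P v) ≤ |a x| + |a y| := by
    have h3 : a v * (P v ⬝ᵥ P v) = -(a x * (P v ⬝ᵥ P x) + a y * (P v ⬝ᵥ P y)) := by linarith
    have h4 := congrArg abs h3
    rw [abs_mul, abs_of_nonneg (by linarith : 0 ≤ P v ⬝ᵥ P v), abs_neg] at h4
    rw [h4]
    refine (abs_add_le _ _).trans ?_
    rw [abs_mul, abs_mul, hax, hay, mul_one, mul_one]
  have hvnn := abs_nonneg (a v)
  rcases hall w hwV hne.symm hd with rfl | rfl <;> nlinarith

/-- The relations on a component which vanish at a given vertex are proportional. -/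
lemma eq_zero_of_two_relations (hV : IsTwoRegular P V) {b : α → ℤ}
    (ha : ∑ u ∈ V, a u • P u = 0) (hb : ∑ u ∈ V, b u • P u = 0) {v s t : α} (hv : v ∈ V)
    (hav : a v = 0) (hbv : b v = 0) (hs : Relation.EqvGen (Adjacent P V) v s)
    (ht : Relation.EqvGen (Adjacent P V) v t) (has : a s ≠ 0) (hbs : b s = 0) : b t = 0 := by
  obtain ⟨x, hx, y, hy, hxv, hyv, hxy, hx1, hy1, hall⟩ := hV v hv
  have hvx : Adjacent P V v x := ⟨hv, hx, hxv.symm, fun h0 => by simp [h0] at hx1⟩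
  have h := hV.eq_zero_of_adjacent (a := fun u => b x * a u - a x * b u) ?_ hvx (by simp [hav, hbv])
    (by ring) hs
  · simp only [hbs, mul_zero, sub_zero, mul_eq_zero, has, or_false] at h
    exact hV.eq_zero_of_adjacent hb hvx hbv h ht
  · simp only [sub_smul, mul_smul, sum_sub_distrib, ← smul_sum, ha, hb, smul_zero, sub_zero]

end IsTwoRegular

end TwoRegular

section Rotate

lemma IsIteratedBlowup.rotate_one {s : List ℕ} (h : IsIteratedBlowup s) :
    IsIteratedBlowup (s.rotate 1) := by
  induction h with
  | refl => exact .refl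
  | tail hs hst ih =>
    cases hst with
    | left a b m =>
      refine Relation.ReflTransGen.tail hs ?_
      simpa using IsBlowup.right a b m
    | middle a b p s =>
      rcases p with _ | ⟨x, p⟩
      · refine ih.tail ?_
        simpa using IsBlowup.left b a s
      · refine ih.tail ?_
        simpa using IsBlowup.middle a b p (s ++ [x])
    | right a b m =>
      refine ih.tail ?_
      simpa using IsBlowup.middle b a m []

lemma IsIteratedBlowup.rotate {s : List ℕ} (h : IsIteratedBlowup s) (n : ℕ) :
    IsIteratedBlowup (s.rotate n) := by
  induction n with
  | zero => simpa using h
  | succ n ih => rw [← List.rotate_rotate]; exact ih.rotate_one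

end Rotate

section Lattice

variable {N : ℕ} {V : Finset (Fin N → ℤ)}

lemma negForm_eq (u v : Fin N → ℤ) : negForm N u v = -(u ⬝ᵥ v) := rfl

lemma IsCircular.dotProduct_cases (hV : IsCircular N V) {u v : Fin N → ℤ} (hu : u ∈ V)
    (hv : v ∈ V) (huv : u ≠ v) : u ⬝ᵥ v = -1 ∨ u ⬝ᵥ v = 0 ∨ u ⬝ᵥ v = 1 := by
  have := hV.2.1 u hu v hv huv
  simp only [negForm_eq] at this
  omega

lemma IsCircular.isTwoRegular (hV : IsCircular N V) :
    IsTwoRegular (id : (Fin N → ℤ) → Fin N → ℤ) V := by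
  intro v hv
  obtain ⟨x, y, hxy, hfilter⟩ := card_eq_two.1 (hV.2.2 v hv)
  have hmem : ∀ u, (u ∈ V ∧ u ≠ v ∧ (negForm N u v = 1 ∨ negForm N u v = -1)) ↔
      u = x ∨ u = y := by
    intro u
    simpa using Finset.ext_iff.1 hfilter u
  have hx := (hmem x).2 (.inl rfl)
  have hy := (hmem y).2 (.inr rfl)
  simp only [negForm_eq, dotProduct_comm _ v] at hmem hx hy
  refine ⟨x, hx.1, y, hy.1, hx.2.1, hy.2.1, hxy, ?_, ?_, fun u hu huv hne => ?_⟩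
  · have h : v ⬝ᵥ x = 1 ∨ v ⬝ᵥ x = -1 := by omega
    rcases h with h | h <;> simp [h]
  · have h : v ⬝ᵥ y = 1 ∨ v ⬝ᵥ y = -1 := by omega
    rcases h with h | h <;> simp [h]
  · refine (hmem u).1 ⟨hu, huv, ?_⟩
    have := hV.dotProduct_cases hv hu huv.symm
    simp only [id] at hne
    omega

lemma conn_iff {u v : Fin N → ℤ} :
    Conn N V u v ↔ Relation.EqvGen (Adjacent (id : (Fin N → ℤ) → Fin N → ℤ) V) u v := by
  constructor
  · intro h
    induction h with
    | rel u v h =>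
      by_cases huv : u = v
      · exact huv ▸ .refl _
      · exact .rel _ _ ⟨h.1, h.2.1, huv, fun h0 => h.2.2 (by simpa [negForm_eq] using h0)⟩
    | refl u => exact .refl u
    | symm u v _ ih => exact ih.symm
    | trans u v w _ _ ih₁ ih₂ => exact ih₁.trans _ _ _ ih₂
  · intro h
    induction h with
    | rel u v h =>
      exact .rel _ _ ⟨h.1, h.2.1, fun h0 => h.2.2.2 (by simpa [negForm_eq] using h0)⟩
    | refl u => exact .refl u
    | symm u v _ ih => exact ih.symm
    | trans u v w _ _ ih₁ ih₂ => exact ih₁.trans _ _ _ ih₂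

lemma mem_compOf {u v : Fin N → ℤ} : u ∈ compOf N V v ↔ u ∈ V ∧ Conn N V u v := by
  classical
  simp [compOf]

lemma compOf_eq_iff {u v : Fin N → ℤ} (hu : u ∈ V) :
    compOf N V u = compOf N V v ↔ Conn N V u v := by
  constructor
  · intro h
    exact (mem_compOf.1 (h ▸ mem_compOf.2 ⟨hu, .refl u⟩)).2
  · intro h
    ext x
    rw [mem_compOf, mem_compOf]
    exact and_congr_right fun _ => ⟨fun hx => hx.trans _ _ _ h, fun hx => hx.trans _ _ _ (h.symm)⟩

lemma conn_of_dotProduct_ne_zero {u v : Fin N → ℤ} (hu : u ∈ V) (hv : v ∈ V) (h : u ⬝ᵥ v ≠ 0) :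
    Conn N V u v :=
  .rel _ _ ⟨hu, hv, by simpa [negForm_eq] using h⟩

/-- The set of all connected components of `V`. -/
noncomputable def components (N : ℕ) (V : Finset (Fin N → ℤ)) : Finset (Finset (Fin N → ℤ)) := by
  classical exact V.image (compOf N V)

lemma mem_components {C : Finset (Fin N → ℤ)} :
    C ∈ components N V ↔ ∃ v ∈ V, compOf N V v = C := by
  simp [components]

lemma sum_eq_sum_components {M : Type*} [AddCommMonoid M] (f : (Fin N → ℤ) → M) :
    ∑ v ∈ V, f v = ∑ C ∈ components N V, ∑ v ∈ C, f v := by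
  classical
  rw [← sum_fiberwise_of_maps_to (s := V) (t := components N V) (g := compOf N V)
    fun v hv => mem_components.2 ⟨v, hv, rfl⟩]
  refine sum_congr rfl fun C hC => sum_congr ?_ fun _ _ => rfl
  obtain ⟨v, hv, rfl⟩ := mem_components.1 hC
  ext u
  rw [mem_filter, mem_compOf]
  exact and_congr_right fun hu => compOf_eq_iff hu

lemma IsSemipositive.sum_dotProduct_components (hV : IsSemipositive N V) {C}
    (hC : C ∈ components N V) :
    ∑ v ∈ C, ∑ u ∈ V.erase v, u ⬝ᵥ v = 4 - 2 * (C.card : ℤ) := by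
  classical
  obtain ⟨v₀, hv₀, rfl⟩ := mem_components.1 hC
  have hsub : ∀ v ∈ compOf N V v₀, v ∈ V := fun v hv => (mem_compOf.1 hv).1
  have h1 : ∀ v ∈ compOf N V v₀, ∑ u ∈ V.erase v, u ⬝ᵥ v =
      2 * ((compOf N V v₀).filter fun u => u ≠ v ∧ negForm N u v = -1).card - 2 := by
    intro v hv
    have h2 := hV.1.2.2 v (hsub v hv)
    have h3 : (compOf N V v₀).filter (fun u => u ≠ v ∧ negForm N u v = -1) =
        (V.erase v).filter fun u => negForm N u v = -1 := by
      ext u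
      simp only [mem_filter, mem_erase, mem_compOf]
      constructor
      · rintro ⟨⟨hu, -⟩, huv, h⟩
        exact ⟨⟨huv, hu⟩, h⟩
      · rintro ⟨⟨huv, hu⟩, h⟩
        refine ⟨⟨hu, .trans _ _ _ (.rel _ _ ⟨hu, hsub v hv, ?_⟩) (mem_compOf.1 hv).2⟩, huv, h⟩
        rw [h]; norm_num
    have h4 : (V.filter fun u => u ≠ v ∧ (negForm N u v = 1 ∨ negForm N u v = -1)) =
        (V.erase v).filter fun u => negForm N u v = 1 ∨ negForm N u v = -1 := by
      ext u
      simp only [mem_filter, mem_erase]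
      tauto
    rw [h4] at h2
    have h5 : (2 : ℤ) = ∑ u ∈ V.erase v,
        if negForm N u v = 1 ∨ negForm N u v = -1 then 1 else 0 := by
      rw [sum_boole, h2]; rfl
    rw [h3, ← sum_boole, h5, mul_sum, ← sum_sub_distrib]
    refine sum_congr rfl fun u hu => ?_
    have h6 := hV.1.2.1 u (mem_of_mem_erase hu) v (hsub v hv) (ne_of_mem_erase hu)
    have h7 := negForm_eq u v
    split_ifs <;> omega
  have h8 := hV.2 v₀ hv₀
  have h9 : ∑ v ∈ compOf N V v₀,
      ((compOf N V v₀).filter fun u => u ≠ v ∧ negForm N u v = -1).card = 2 := by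
    rw [← h8, card_filter, sum_product_right]
    exact sum_congr rfl fun v _ => card_filter _ _
  rw [sum_congr rfl h1, sum_sub_distrib, ← mul_sum, ← Nat.cast_sum, h9, sum_const, nsmul_eq_mul]
  push_cast
  ring

lemma sum_dotProduct_sum (V : Finset (Fin N → ℤ)) :
    (∑ v ∈ V, v) ⬝ᵥ (∑ v ∈ V, v) = ∑ v ∈ V, v ⬝ᵥ v + ∑ v ∈ V, ∑ u ∈ V.erase v, u ⬝ᵥ v := by
  rw [dotProduct_sum, ← sum_add_distrib]
  exact sum_congr rfl fun v hv => by 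
    rw [sum_dotProduct]; exact (add_sum_erase V (fun u => u ⬝ᵥ v) hv).symm

/-- If all components have the prescribed total square, then `V` has `N` elements and these have
total square `3 N - 4 k`, where `k` is the number of components. -/
lemma IsSemipositive.card_and_sum_self (hV : IsSemipositive N V)
    (hW : negForm N (∑ v ∈ V, v) (∑ v ∈ V, v) = -(N : ℤ))
    (hcomp : ∀ v ∈ V,
      (∑ u ∈ compOf N V v, (negForm N u u + 2)) = 4 - ((compOf N V v).card : ℤ)) :
    V.card = N ∧ ∑ v ∈ V, v ⬝ᵥ v = 3 * (N : ℤ) - 4 * (components N V).card := by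
  have h1 : ∀ C ∈ components N V, ∑ v ∈ C, v ⬝ᵥ v = 3 * (C.card : ℤ) - 4 := by
    intro C hC
    obtain ⟨v, hv, rfl⟩ := mem_components.1 hC
    have := hcomp v hv
    simp only [negForm_eq, sum_add_distrib, sum_neg_distrib, sum_const, nsmul_eq_mul] at this
    linarith
  have hcard : (V.card : ℤ) = ∑ C ∈ components N V, (C.card : ℤ) := by
    simpa using sum_eq_sum_components (V := V) fun _ => (1 : ℤ)
  have hself : ∑ v ∈ V, v ⬝ᵥ v = 3 * (V.card : ℤ) - 4 * (components N V).card := by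
    rw [sum_eq_sum_components, sum_congr rfl h1, sum_sub_distrib, ← mul_sum, ← hcard, sum_const,
      nsmul_eq_mul]
    ring
  have hoff : ∑ v ∈ V, ∑ u ∈ V.erase v, u ⬝ᵥ v = 4 * (components N V).card - 2 * (V.card : ℤ) := by
    rw [sum_eq_sum_components, sum_congr rfl fun C hC => hV.sum_dotProduct_components hC,
      sum_sub_distrib, ← mul_sum, ← hcard, sum_const, nsmul_eq_mul]
    ring
  rw [negForm_eq, sum_dotProduct_sum, hself, hoff] at hW
  have hVN : V.card = N := by omega
  exact ⟨hVN, by rw [hself, hVN]⟩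

end Lattice

section FreeColumns

variable {N : ℕ} {V : Finset (Fin N → ℤ)}

/-- The Wu element is characteristic on the lattice spanned by a circular subset. -/
lemma IsCircular.even_sum_dotProduct_sub (hV : IsCircular N V) {x : Fin N → ℤ}
    (hx : x ∈ AddSubgroup.closure (V : Set (Fin N → ℤ))) :
    Even ((∑ v ∈ V, v) ⬝ᵥ x - x ⬝ᵥ x) := by
  classical
  induction hx using AddSubgroup.closure_induction with
  | mem x hx =>
    obtain ⟨y, hy, z, hz, hyx, hzx, hyz, hy1, hz1, hall⟩ := hV.isTwoRegular x hx
    have hsub : ({y, z} : Finset (Fin N → ℤ)) ⊆ V.erase x := by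
      intro u hu
      simp only [mem_insert, mem_singleton] at hu
      rcases hu with rfl | rfl <;> simp_all
    have hsum : (∑ v ∈ V, v) ⬝ᵥ x - x ⬝ᵥ x = x ⬝ᵥ y + x ⬝ᵥ z := by
      rw [← add_sum_erase V (fun v => v) hx, add_dotProduct, add_sub_cancel_left, sum_dotProduct,
        ← sum_subset hsub, sum_pair hyz, dotProduct_comm y, dotProduct_comm z]
      intro u hu hu'
      by_contra hne
      refine hu' ?_
      rw [mem_insert, mem_singleton]
      exact hall u (mem_of_mem_erase hu) (ne_of_mem_erase hu)
        (fun h0 => hne (by rw [dotProduct_comm]; exact h0))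
    rw [hsum]
    simp only [id] at hy1 hz1
    rcases sq_eq_one_iff.1 hy1 with h | h <;>
      rcases sq_eq_one_iff.1 hz1 with h' | h' <;> simp [h, h']
  | zero => simp
  | add x y _ _ hx hy =>
    have h : (∑ v ∈ V, v) ⬝ᵥ (x + y) - (x + y) ⬝ᵥ (x + y) =
        ((∑ v ∈ V, v) ⬝ᵥ x - x ⬝ᵥ x) + ((∑ v ∈ V, v) ⬝ᵥ y - y ⬝ᵥ y) - 2 * (x ⬝ᵥ y) := by
      simp only [dotProduct_add, add_dotProduct, dotProduct_comm y x]
      ring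
    rw [h]
    exact (hx.add hy).sub (even_two_mul _)
  | neg x _ hx =>
    have h : (∑ v ∈ V, v) ⬝ᵥ (-x) - (-x) ⬝ᵥ (-x) =
        ((∑ v ∈ V, v) ⬝ᵥ x - x ⬝ᵥ x) - 2 * ((∑ v ∈ V, v) ⬝ᵥ x) := by
      simp only [dotProduct_neg, neg_dotProduct]
      ring
    rw [h]
    exact hx.sub (even_two_mul _)

lemma IsCircular.odd_sum_sq (hV : IsCircular N V)
    (hodd : Odd (AddSubgroup.closure (V : Set (Fin N → ℤ))).index) (e : Fin N) :
    Odd (∑ v ∈ V, v e ^ 2) := by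
  set d := (AddSubgroup.closure (V : Set (Fin N → ℤ))).index
  have h1 := hV.even_sum_dotProduct_sub
    (AddSubgroup.nsmul_index_mem (AddSubgroup.closure (V : Set (Fin N → ℤ))) (Pi.single e 1))
  have hd : Odd (d : ℤ) := by exact_mod_cast hodd
  simp only [dotProduct_smul, dotProduct_single, mul_one, Finset.sum_apply, Pi.smul_apply,
    Pi.single_eq_same] at h1
  simp only [nsmul_eq_mul, mul_one] at h1
  have h2 : Even (∑ v ∈ V, v e ^ 2 - ∑ v ∈ V, v e) := by
    rw [← sum_sub_distrib]
    refine even_sum _ fun v _ => ?_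
    rw [show v e ^ 2 - v e = (v e - 1) * (v e - 1 + 1) by ring]
    exact Int.even_mul_succ_self _
  rw [← mul_sub, Int.even_mul] at h1
  have h3 := h1.resolve_left (by rwa [Int.not_even_iff_odd])
  have h4 := (h2.add h3).add_odd hd
  simpa [d] using h4

/-- The coordinates in which exactly one vector of `V` is nonzero, this coordinate being `±1`. -/
def freeColumns (V : Finset (Fin N → ℤ)) : Finset (Fin N) :=
  univ.filter fun e => ∑ v ∈ V, v e ^ 2 = 1

lemma IsSemipositive.two_mul_card_components_le (hV : IsSemipositive N V)
    (hodd : Odd (AddSubgroup.closure (V : Set (Fin N → ℤ))).index)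
    (hW : negForm N (∑ v ∈ V, v) (∑ v ∈ V, v) = -(N : ℤ))
    (hcomp : ∀ v ∈ V,
      (∑ u ∈ compOf N V v, (negForm N u u + 2)) = 4 - ((compOf N V v).card : ℤ)) :
    2 * (components N V).card ≤ (freeColumns V).card := by
  have h1 := (hV.card_and_sum_self hW hcomp).2
  have h2 : ∑ v ∈ V, v ⬝ᵥ v = ∑ e, ∑ v ∈ V, v e ^ 2 := by
    rw [sum_comm]
    exact sum_congr rfl fun v _ => sum_congr rfl fun e _ => (sq _).symm
  have h3 : ∑ e : Fin N, ((3 : ℤ) - 2 * if ∑ v ∈ V, v e ^ 2 = 1 then 1 else 0) ≤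
      ∑ e, ∑ v ∈ V, v e ^ 2 := by
    refine sum_le_sum fun e _ => ?_
    have h4 := hV.1.odd_sum_sq hodd e
    have h5 : 0 ≤ ∑ v ∈ V, v e ^ 2 := sum_nonneg fun v _ => sq_nonneg _
    split_ifs with h
    · omega
    · obtain ⟨k, hk⟩ := h4
      omega
  rw [sum_sub_distrib, ← mul_sum, sum_boole, ← h2, h1, sum_const, card_univ, Fintype.card_fin,
    nsmul_eq_mul] at h3
  change _ - 2 * ((freeColumns V).card : ℤ) ≤ _ at h3
  omega

/-- `v` is the only element of `V` with a nonzero coordinate at `f`, and this coordinate is `±1`. -/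
def IsFreeRow (V : Finset (Fin N → ℤ)) (f : Fin N) (v : Fin N → ℤ) : Prop :=
  v ∈ V ∧ v f ^ 2 = 1 ∧ ∀ u ∈ V, u ≠ v → u f = 0

lemma exists_isFreeRow {f : Fin N} (hf : f ∈ freeColumns V) : ∃ v, IsFreeRow V f v := by
  classical
  have h1 : ∑ v ∈ V, v f ^ 2 = 1 := (mem_filter.1 hf).2
  obtain ⟨v, hv, hne⟩ := exists_ne_zero_of_sum_ne_zero (h1.trans_ne one_ne_zero)
  have h2 := add_sum_erase V (fun v => v f ^ 2) hv
  have h3 : 0 ≤ ∑ u ∈ V.erase v, u f ^ 2 := sum_nonneg fun u _ => sq_nonneg _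
  have h4 : 0 < v f ^ 2 := lt_of_le_of_ne (sq_nonneg _) hne.symm
  rw [h1] at h2
  refine ⟨v, hv, by omega, fun u hu huv => ?_⟩
  have h5 := (sum_eq_zero_iff_of_nonneg fun u _ => sq_nonneg (u f)).1
    (show ∑ u ∈ V.erase v, u f ^ 2 = 0 by omega) u (mem_erase.2 ⟨huv, hu⟩)
  simpa using h5

lemma exists_sum_smul_of_mem_closure {x : Fin N → ℤ}
    (hx : x ∈ AddSubgroup.closure (V : Set (Fin N → ℤ))) :
    ∃ a : (Fin N → ℤ) → ℤ, ∑ u ∈ V, a u • u = x := by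
  rw [← Submodule.span_int_eq_addSubgroupClosure, Submodule.mem_toAddSubgroup,
    Submodule.mem_span_finset] at hx
  obtain ⟨a, -, ha⟩ := hx
  exact ⟨a, ha⟩

/-- A free coordinate gives a linear relation, supported on a single component, between the
vectors obtained by forgetting this coordinate. -/
lemma IsFreeRow.exists_relation {f : Fin N} {v : Fin N → ℤ} (hv : IsFreeRow V f v)
    (hodd : Odd (AddSubgroup.closure (V : Set (Fin N → ℤ))).index) :
    ∃ a : (Fin N → ℤ) → ℤ, (∀ u ∈ V, u ∉ compOf N V v → a u = 0) ∧ a v ≠ 0 ∧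
      ∀ e, e ≠ f → ∑ u ∈ V, a u * u e = 0 := by
  classical
  set d := (AddSubgroup.closure (V : Set (Fin N → ℤ))).index
  obtain ⟨a, ha⟩ := exists_sum_smul_of_mem_closure
    (AddSubgroup.nsmul_index_mem (AddSubgroup.closure (V : Set (Fin N → ℤ))) (Pi.single f 1))
  have hcoord : ∀ e, ∑ u ∈ V, a u * u e = d * (Pi.single f 1 : Fin N → ℤ) e := by
    intro e
    simpa [Finset.sum_apply] using congrFun ha e
  set y := ∑ u ∈ V \ compOf N V v, a u • u
  have hself : v ∈ compOf N V v := mem_compOf.2 ⟨hv.1, .refl v⟩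
  have hsub : compOf N V v ⊆ V := fun u hu => (mem_compOf.1 hu).1
  have hy : y = 0 := by
    have hsplit : y + ∑ u ∈ compOf N V v, a u • u = d • Pi.single f 1 := by
      rw [← ha]; exact sum_sdiff hsub
    have h1 : y ⬝ᵥ ∑ u ∈ compOf N V v, a u • u = 0 := by
      rw [sum_dotProduct]
      refine sum_eq_zero fun u hu => ?_
      rw [dotProduct_sum]
      refine sum_eq_zero fun u' hu' => ?_
      rw [mem_sdiff, mem_compOf] at hu
      rw [mem_compOf] at hu'
      have : u ⬝ᵥ u' = 0 := by
        by_contra hne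
        exact hu.2 ⟨hu.1, (conn_of_dotProduct_ne_zero hu.1 hu'.1 hne).trans _ _ _ hu'.2⟩
      rw [smul_dotProduct, dotProduct_smul, this, smul_zero, smul_zero]
    have h2 : y f = 0 := by
      simp only [y, Finset.sum_apply, Pi.smul_apply, smul_eq_mul]
      refine sum_eq_zero fun u hu => ?_
      rw [mem_sdiff] at hu
      rw [hv.2.2 u hu.1 (fun h => hu.2 (h ▸ hself)), mul_zero]
    have h3 := congrArg (y ⬝ᵥ ·) hsplit
    simp only [dotProduct_add, h1, add_zero, dotProduct_smul, dotProduct_single, h2, zero_mul,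
      smul_zero] at h3
    exact dotProduct_self_eq_zero.1 h3
  have hsum : ∀ e, ∑ u ∈ compOf N V v, a u * u e = ∑ u ∈ V, a u * u e := by
    intro e
    rw [← sum_sdiff hsub]
    have := congrFun hy e
    simp only [y, Finset.sum_apply, Pi.smul_apply, smul_eq_mul, Pi.zero_apply] at this
    rw [this, zero_add]
  refine ⟨fun u => if u ∈ compOf N V v then a u else 0, fun u _ hu => if_neg hu, ?_, ?_⟩
  · simp only [if_pos hself]
    intro h0
    have h4 := hcoord f
    rw [sum_eq_zero, Pi.single_eq_same, mul_one] at h4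
    · obtain ⟨k, hk⟩ := hodd
      change d = _ at hk
      omega
    · intro u hu
      by_cases huv : u = v
      · rw [huv, h0, zero_mul]
      · rw [hv.2.2 u hu huv, mul_zero]
  · intro e he
    simp only [ite_mul, zero_mul]
    rw [sum_ite_mem, inter_eq_right.2 hsub, hsum, hcoord, Pi.single_eq_of_ne he, mul_zero]

end FreeColumns

section Projection

variable {N : ℕ} {V : Finset (Fin N → ℤ)}

/-- Forgetting the coordinates in `F`. -/
def forget (F : Finset (Fin N)) (u : Fin N → ℤ) : Fin N → ℤ := fun e => if e ∈ F then 0 else u e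

lemma forget_dotProduct (F : Finset (Fin N)) (u v : Fin N → ℤ) :
    forget F u ⬝ᵥ forget F v = u ⬝ᵥ v - ∑ f ∈ F, u f * v f := by
  have h := sum_filter_add_sum_filter_not univ (· ∈ F) fun e => u e * v e
  rw [filter_mem_eq_inter, univ_inter, sum_filter] at h
  rw [dotProduct, dotProduct, ← h, add_sub_cancel_left]
  refine sum_congr rfl fun e _ => ?_
  by_cases he : e ∈ F <;> simp [forget, he]

lemma forget_dotProduct_of_ne {u v : Fin N → ℤ} (hu : u ∈ V) (hv : v ∈ V) (huv : u ≠ v) :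
    forget (freeColumns V) u ⬝ᵥ forget (freeColumns V) v = u ⬝ᵥ v := by
  rw [forget_dotProduct, sum_eq_zero, sub_zero]
  intro f hf
  obtain ⟨r, -, -, hr⟩ := exists_isFreeRow hf
  by_cases hur : u = r
  · rw [hr v hv (fun h => huv (hur.trans h.symm)), mul_zero]
  · rw [hr u hu hur, zero_mul]

lemma IsFreeRow.eq {f : Fin N} {u v : Fin N → ℤ} (hu : IsFreeRow V f u) (hv : IsFreeRow V f v) :
    u = v := by
  by_contra h
  have := hu.2.1
  rw [hv.2.2 u hu.1 h] at this
  norm_num at this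

lemma IsFreeRow.eq_zero_of_relation {f g : Fin N} {u : Fin N → ℤ} (hu : IsFreeRow V g u)
    {a : (Fin N → ℤ) → ℤ} (ha : ∀ e, e ≠ f → ∑ u ∈ V, a u * u e = 0) (hgf : g ≠ f) : a u = 0 := by
  have h := ha g hgf
  rw [sum_eq_single_of_mem u hu.1 fun v hv hvu => by rw [hu.2.2 v hv hvu, mul_zero]] at h
  refine (mul_eq_zero.1 h).resolve_right fun h0 => ?_
  have := hu.2.1
  rw [h0] at this
  norm_num at this

lemma forget_dotProduct_self_of_isFreeRow
    (hodd : Odd (AddSubgroup.closure (V : Set (Fin N → ℤ))).index) {f : Fin N}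
    (hf : f ∈ freeColumns V) {v : Fin N → ℤ} (hv : IsFreeRow V f v) :
    forget (freeColumns V) v ⬝ᵥ forget (freeColumns V) v = v ⬝ᵥ v - 1 := by
  rw [forget_dotProduct, sum_eq_single_of_mem f hf, ← sq, hv.2.1]
  intro g hg hgf
  obtain ⟨u, hu⟩ := exists_isFreeRow hg
  obtain ⟨a, -, hav, ha⟩ := hv.exists_relation hodd
  rw [hu.2.2 v hv.1 fun h => hav (h ▸ hu.eq_zero_of_relation ha hgf), mul_zero]

lemma forget_dotProduct_self_of_forall {v : Fin N → ℤ} (hv : v ∈ V)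
    (h : ∀ f ∈ freeColumns V, ¬ IsFreeRow V f v) :
    forget (freeColumns V) v ⬝ᵥ forget (freeColumns V) v = v ⬝ᵥ v := by
  rw [forget_dotProduct, sum_eq_zero, sub_zero]
  intro f hf
  obtain ⟨r, hr⟩ := exists_isFreeRow hf
  rw [hr.2.2 v hv fun hvr => h f hf (hvr ▸ hr), zero_mul]

lemma sum_smul_forget_eq_zero {f : Fin N} (hf : f ∈ freeColumns V) {a : (Fin N → ℤ) → ℤ}
    (ha : ∀ e, e ≠ f → ∑ u ∈ V, a u * u e = 0) :
    ∑ u ∈ V, a u • forget (freeColumns V) u = 0 := by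
  ext e
  simp only [Finset.sum_apply, Pi.smul_apply, smul_eq_mul, Pi.zero_apply, forget]
  split_ifs with h
  · simp
  · exact ha e fun hef => h (hef ▸ hf)

lemma adjacent_forget_iff {u v : Fin N → ℤ} :
    Adjacent (forget (freeColumns V)) V u v ↔
      Adjacent (id : (Fin N → ℤ) → Fin N → ℤ) V u v := by
  refine and_congr_right fun hu => and_congr_right fun hv => and_congr_right fun huv => ?_
  rw [forget_dotProduct_of_ne hu hv huv]
  rfl

lemma conn_iff_forget {u v : Fin N → ℤ} :
    Conn N V u v ↔ Relation.EqvGen (Adjacent (forget (freeColumns V)) V) u v := by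
  rw [conn_iff, show Adjacent (forget (freeColumns V)) V = Adjacent id V from
    funext₂ fun _ _ => propext adjacent_forget_iff]

lemma IsCircular.isTwoRegular_forget (hV : IsCircular N V) :
    IsTwoRegular (forget (freeColumns V)) V := by
  intro v hv
  obtain ⟨x, hx, y, hy, hxv, hyv, hxy, hx1, hy1, hall⟩ := hV.isTwoRegular v hv
  refine ⟨x, hx, y, hy, hxv, hyv, hxy, ?_, ?_, fun u hu huv h => hall u hu huv ?_⟩
  · rwa [forget_dotProduct_of_ne hv hx hxv.symm]
  · rwa [forget_dotProduct_of_ne hv hy hyv.symm]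
  · rwa [forget_dotProduct_of_ne hv hu huv.symm] at h

open scoped Classical in
/-- The free columns whose free row belongs to the component `C`. -/
noncomputable def freeColumnsOf (V C : Finset (Fin N → ℤ)) : Finset (Fin N) :=
  (freeColumns V).filter fun f => ∃ v ∈ C, IsFreeRow V f v

lemma IsCircular.card_freeColumnsOf_le (hV : IsCircular N V)
    (hodd : Odd (AddSubgroup.closure (V : Set (Fin N → ℤ))).index) {C}
    (hC : C ∈ components N V) : (freeColumnsOf V C).card ≤ 2 := by
  classical
  obtain ⟨v₀, -, rfl⟩ := mem_components.1 hC
  by_contra! h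
  obtain ⟨f, g, k, hf, hg, hk, hfg, hfk, hgk⟩ := two_lt_card_iff.1 h
  simp only [freeColumnsOf, mem_filter] at hf hg hk
  obtain ⟨hf, u, huC, hu⟩ := hf
  obtain ⟨hg, v, hvC, hv⟩ := hg
  obtain ⟨hk, w, hwC, hw⟩ := hk
  obtain ⟨a, -, hav, ha⟩ := hv.exists_relation hodd
  obtain ⟨b, -, hbw, hb⟩ := hw.exists_relation hodd
  have hconn : ∀ x ∈ compOf N V v₀, Relation.EqvGen (Adjacent (forget (freeColumns V)) V) u x :=
    fun x hx => conn_iff_forget.1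
      ((mem_compOf.1 huC).2.trans _ _ _ (.symm _ _ (mem_compOf.1 hx).2))
  exact hbw (hV.isTwoRegular_forget.eq_zero_of_two_relations (sum_smul_forget_eq_zero hg ha)
    (sum_smul_forget_eq_zero hk hb) hu.1 (hu.eq_zero_of_relation ha hfg)
    (hu.eq_zero_of_relation hb hfk) (hconn v hvC) (hconn w hwC) hav
    (hv.eq_zero_of_relation hb hgk))

lemma card_freeColumns : (freeColumns V).card = ∑ C ∈ components N V, (freeColumnsOf V C).card := by
  classical
  choose! r hr using fun f (hf : f ∈ freeColumns V) => exists_isFreeRow hf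
  rw [card_eq_sum_card_fiberwise (f := fun f => compOf N V (r f)) (t := components N V)
    fun f hf => mem_components.2 ⟨_, (hr f hf).1, rfl⟩]
  refine sum_congr rfl fun C hC => congrArg card ?_
  obtain ⟨v, hv, rfl⟩ := mem_components.1 hC
  ext f
  simp only [freeColumnsOf, mem_filter]
  refine and_congr_right fun hf => ?_
  rw [compOf_eq_iff (hr f hf).1]
  constructor
  · exact fun h => ⟨r f, mem_compOf.2 ⟨(hr f hf).1, h⟩, hr f hf⟩
  · rintro ⟨u, hu, huf⟩
    rw [(hr f hf).eq huf]
    exact (mem_compOf.1 hu).2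

/-- There is a family of vectors with the same mutual products as `V` in which, on a given
component, exactly two vectors `p` and `q` have square one, the squares of the other ones being
those of `V`, and which satisfies two independent linear relations on this component. -/
lemma IsSemipositive.exists_projection (hV : IsSemipositive N V)
    (hodd : Odd (AddSubgroup.closure (V : Set (Fin N → ℤ))).index)
    (hW : negForm N (∑ v ∈ V, v) (∑ v ∈ V, v) = -(N : ℤ))
    (hsq : ∀ v ∈ V, negForm N v v ≤ -2)
    (hcomp : ∀ v ∈ V,
      (∑ u ∈ compOf N V v, (negForm N u u + 2)) = 4 - ((compOf N V v).card : ℤ))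
    {C : Finset (Fin N → ℤ)} (hC : C ∈ components N V) :
    ∃ P : (Fin N → ℤ) → Fin N → ℤ, ∃ p ∈ C, ∃ q ∈ C, p ≠ q ∧
      (∀ u ∈ V, ∀ v ∈ V, u ≠ v → P u ⬝ᵥ P v = u ⬝ᵥ v) ∧
      P p ⬝ᵥ P p = 1 ∧ P q ⬝ᵥ P q = 1 ∧ (∀ u ∈ C, u ≠ p → u ≠ q → P u ⬝ᵥ P u = u ⬝ᵥ u) ∧
      (∃ a : (Fin N → ℤ) → ℤ, ∑ u ∈ C, a u • P u = 0 ∧ a p ≠ 0 ∧ a q = 0) ∧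
      ∃ a : (Fin N → ℤ) → ℤ, ∑ u ∈ C, a u • P u = 0 ∧ a p = 0 ∧ a q ≠ 0 := by
  classical
  have hcard : (freeColumnsOf V C).card = 2 := by
    refine le_antisymm (hV.1.card_freeColumnsOf_le hodd hC) ?_
    by_contra! hlt
    have h1 := sum_lt_sum (fun D hD => hV.1.card_freeColumnsOf_le hodd hD) ⟨C, hC, hlt⟩
    have h2 := hV.two_mul_card_components_le hodd hW hcomp
    rw [← card_freeColumns, sum_const, smul_eq_mul] at h1
    omega
  obtain ⟨v₀, -, rfl⟩ := mem_components.1 hC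
  obtain ⟨f, g, hfg, hfg'⟩ := card_eq_two.1 hcard
  have hmem : ∀ k, (k ∈ freeColumns V ∧ ∃ v ∈ compOf N V v₀, IsFreeRow V k v) ↔ k = f ∨ k = g := by
    intro k
    simpa [freeColumnsOf] using Finset.ext_iff.1 hfg' k
  obtain ⟨hf, p, hpC, hp⟩ := (hmem f).2 (.inl rfl)
  obtain ⟨hg, q, hqC, hq⟩ := (hmem g).2 (.inr rfl)
  have h2 : ∀ u ∈ V, 2 ≤ u ⬝ᵥ u := fun u hu => by
    have := hsq u hu
    rw [negForm_eq] at this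
    omega
  have hconn : ∀ u ∈ compOf N V v₀, ∀ v ∈ compOf N V v₀, Conn N V u v := fun u hu v hv =>
    (mem_compOf.1 hu).2.trans _ _ _ (.symm _ _ (mem_compOf.1 hv).2)
  have hother : ∀ u ∈ compOf N V v₀, u ≠ p → u ≠ q →
      forget (freeColumns V) u ⬝ᵥ forget (freeColumns V) u = u ⬝ᵥ u := by
    refine fun u hu hup huq => forget_dotProduct_self_of_forall (mem_compOf.1 hu).1 ?_
    intro k hk huk
    rcases (hmem k).1 ⟨hk, u, hu, huk⟩ with rfl | rfl
    · exact hup (huk.eq hp)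
    · exact huq (huk.eq hq)
  have key : ∀ f g p q, f ∈ freeColumns V → f ≠ g → p ∈ compOf N V v₀ → q ∈ compOf N V v₀ →
      IsFreeRow V f p → IsFreeRow V g q → (∀ u ∈ compOf N V v₀, u ≠ p → u ≠ q →
        forget (freeColumns V) u ⬝ᵥ forget (freeColumns V) u = u ⬝ᵥ u) →
      forget (freeColumns V) p ⬝ᵥ forget (freeColumns V) p = 1 ∧ ∃ a : (Fin N → ℤ) → ℤ,
        ∑ u ∈ compOf N V v₀, a u • forget (freeColumns V) u = 0 ∧ a p ≠ 0 ∧ a q = 0 := by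
    intro f g p q hf hfg hpC hqC hp hq hother
    obtain ⟨a, hsupp, hap, ha⟩ := hp.exists_relation hodd
    have hcomp : compOf N V p = compOf N V v₀ := (compOf_eq_iff hp.1).2 (mem_compOf.1 hpC).2
    have haq := hq.eq_zero_of_relation ha hfg.symm
    have hsum := sum_smul_forget_eq_zero hf ha
    rw [hcomp] at hsupp
    refine ⟨?_, a, ?_, hap, haq⟩
    · by_contra hne
      refine hap (hV.1.isTwoRegular_forget.eq_zero_of_two_le hsum ?_ hq.1 haq hp.1
        (conn_iff_forget.1 (hconn q hqC p hpC)))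
      intro u hu hau
      by_cases hup : u = p
      · have := h2 p hp.1
        have := forget_dotProduct_self_of_isFreeRow hodd hf hp
        rw [hup]
        omega
      · have huC : u ∈ compOf N V v₀ := by
          by_contra h
          exact hau (hsupp u hu h)
        rw [hother u huC hup fun h => hau (h ▸ haq)]
        exact h2 u hu
    · rw [← hsum]
      exact sum_subset (fun u hu => (mem_compOf.1 hu).1)
        fun u hu hu' => by rw [hsupp u hu hu', zero_smul]
  obtain ⟨hp1, a, ha, hap, haq⟩ := key f g p q hf hfg hpC hqC hp hq hother
  obtain ⟨hq1, b, hb, hbq, hbp⟩ := key g f q p hg hfg.symm hqC hpC hq hp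
    fun u hu h h' => hother u hu h' h
  exact ⟨forget (freeColumns V), p, hpC, q, hqC, fun h => hap (h ▸ haq),
    fun u hu v hv huv => forget_dotProduct_of_ne hu hv huv, hp1, hq1, hother,
    ⟨a, ha, hap, haq⟩, b, hb, hbp, hbq⟩

end Projection

section Listing

variable {N m : ℕ} {V C : Finset (Fin N → ℤ)} {w : ZMod m → Fin N → ℤ}

lemma IsCyclicListing.sum_eq [NeZero m] {M : Type*} [AddCommMonoid M] (hw : IsCyclicListing N C m w)
    (f : (Fin N → ℤ) → M) (k : ZMod m) : ∑ u ∈ C, f u = ∑ i ∈ range m, f (w (k + (i : ℕ))) := by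
  refine (sum_nbij (fun i : ℕ => w (k + i)) (fun i _ => hw.2.2.1 _) ?_ ?_ fun _ _ => rfl).symm
  · intro i hi j hj hij
    have h := add_left_cancel (hw.2.1 hij)
    rw [ZMod.natCast_eq_natCast_iff'] at h
    rwa [Nat.mod_eq_of_lt (by simpa using hi), Nat.mod_eq_of_lt (by simpa using hj)] at h
  · intro c hc
    obtain ⟨i, rfl⟩ := hw.2.2.2.1 c hc
    exact ⟨(i - k).val, by simpa using ZMod.val_lt _, by simp⟩

lemma IsCyclicListing.eq_of_dotProduct_ne_zero (hV : IsCircular N V) (hCV : C ⊆ V) (hm : 3 ≤ m)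
    (hw : IsCyclicListing N C m w) {i j : ZMod m} (hij : i ≠ j) (h : w i ⬝ᵥ w j ≠ 0) :
    j = i + 1 ∨ i = j + 1 := by
  have hcast : ∀ d : ℕ, 0 < d → d < m → (d : ZMod m) ≠ 0 := fun d hd hdm h0 => by
    rw [ZMod.natCast_eq_zero_iff] at h0
    exact absurd (Nat.le_of_dvd hd h0) (by omega)
  have hone : (1 : ZMod m) ≠ 0 := by exact_mod_cast hcast 1 (by omega) (by omega)
  have htwo : (2 : ZMod m) ≠ 0 := by exact_mod_cast hcast 2 (by omega) (by omega)
  have hne : ∀ i, w i ⬝ᵥ w (i + 1) ≠ 0 := fun i h0 => by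
    have := hw.2.2.2.2 i
    simp only [negForm_eq] at this
    omega
  have hmem : ∀ i, w i ∈ V := fun i => hCV (hw.2.2.1 i)
  obtain ⟨x, hx, y, hy, -, -, hxy, -, -, hall⟩ := hV.isTwoRegular (w i) (hmem i)
  have h1 := hall (w (i + 1)) (hmem _) (fun h => hone (by simpa using hw.2.1 h)) (hne i)
  have h2 := hall (w (i - 1)) (hmem _) (fun h => hone (by simpa using hw.2.1 h)) (by
    have := hne (i - 1)
    rwa [sub_add_cancel, dotProduct_comm] at this)
  have h3 := hall (w j) (hmem j) (fun h => hij (hw.2.1 h).symm) h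
  have h4 : w (i + 1) ≠ w (i - 1) := fun h => htwo (by
    have := hw.2.1 h
    linear_combination this)
  have h5 : w j = w (i + 1) ∨ w j = w (i - 1) := by
    rcases h1 with h1 | h1 <;> rcases h2 with h2 | h2 <;> rcases h3 with h3 | h3 <;>
      simp_all
  rcases h5 with h5 | h5
  · exact .inl (hw.2.1 h5)
  · exact .inr (by rw [hw.2.1 h5, sub_add_cancel])

/-- Rotating a cyclic listing of a component of a semipositive circular subset, we may assume that
the positive pairing is the one between the last and the first vector. -/
lemma IsCyclicListing.exists_isCyclicGram (hV : IsSemipositive N V) {v₀ : Fin N → ℤ} (hv₀ : v₀ ∈ V)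
    (hm : 3 ≤ m) (hw : IsCyclicListing N (compOf N V v₀) m w) :
    ∃ k : ZMod m, IsCyclicGram m fun i : ℕ => w (k + i) := by
  classical
  have hCV : compOf N V v₀ ⊆ V := fun u hu => (mem_compOf.1 hu).1
  have hadj := fun i j => hw.eq_of_dotProduct_ne_zero hV.1 hCV hm (i := i) (j := j)
  have hcard := hV.2 v₀ hv₀
  set S := ((compOf N V v₀) ×ˢ (compOf N V v₀)).filter fun p => p.1 ≠ p.2 ∧ negForm N p.1 p.2 = -1
    with hS
  have hne : ∀ i, w i ≠ w (i + 1) := fun i h => by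
    have h1 : (1 : ZMod m) = 0 := by simpa using (hw.2.1 h).symm
    have h2 : ((1 : ℕ) : ZMod m) = 0 := by simpa using h1
    rw [ZMod.natCast_eq_zero_iff, Nat.dvd_one] at h2
    omega
  have hmem : ∀ i j, w i ⬝ᵥ w j = 1 → w i ≠ w j → (w i, w j) ∈ S := fun i j h hne => by
    rw [hS, mem_filter, mem_product]
    exact ⟨⟨hw.2.2.1 i, hw.2.2.1 j⟩, hne, by simp [negForm_eq, h]⟩
  obtain ⟨k, hk⟩ : ∃ k, w k ⬝ᵥ w (k + 1) = 1 := by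
    obtain ⟨⟨u, v⟩, huv⟩ := card_pos.1 (hcard.symm ▸ zero_lt_two)
    rw [hS, mem_filter, mem_product] at huv
    obtain ⟨⟨hu, hv⟩, hne, h⟩ := huv
    obtain ⟨i, rfl⟩ := hw.2.2.2.1 u hu
    obtain ⟨j, rfl⟩ := hw.2.2.2.1 v hv
    simp only [negForm_eq, neg_inj] at h
    rcases hadj i j (fun h => hne (congrArg w h)) (by simp [h]) with rfl | rfl
    · exact ⟨i, h⟩
    · exact ⟨j, by rwa [dotProduct_comm]⟩
  have hunique : ∀ i, w i ⬝ᵥ w (i + 1) = 1 → i = k := by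
    intro i hi
    by_contra hik
    have hsub : ({(w k, w (k + 1)), (w (k + 1), w k), (w i, w (i + 1))} : Finset _) ⊆ S := by
      intro x hx
      simp only [mem_insert, mem_singleton] at hx
      rcases hx with rfl | rfl | rfl
      · exact hmem _ _ hk (hne k)
      · exact hmem _ _ (by rwa [dotProduct_comm]) (hne k).symm
      · exact hmem _ _ hi (hne i)
    have hle := card_le_card hsub
    rw [hcard, card_insert_of_notMem, card_pair] at hle
    · omega
    · intro h
      rw [Prod.mk.injEq] at h
      have h1 := hw.2.1 h.1
      have h2 := hw.2.1 h.2
      have h3 : ((2 : ℕ) : ZMod m) = 0 := by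
        push_cast
        linear_combination h1 - h2
      rw [ZMod.natCast_eq_zero_iff] at h3
      exact absurd (Nat.le_of_dvd two_pos h3) (by omega)
    · simp only [mem_insert, mem_singleton, Prod.mk.injEq, not_or, not_and]
      exact ⟨fun h => absurd h (hne k), fun h => absurd (hw.2.1 h).symm hik⟩
  refine ⟨k + 1, ⟨fun i hi => ?_, fun i hi => ?_, fun i j hij hj h0 => ?_⟩⟩
  · have h1 := hw.2.2.2.2 (k + 1 + i)
    simp only [negForm_eq] at h1
    rw [Nat.cast_succ, ← add_assoc]
    rcases h1 with h1 | h1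
    · omega
    · have h2 : ((i + 1 : ℕ) : ZMod m) = 0 := by
        push_cast
        linear_combination hunique _ (neg_injective h1)
      rw [ZMod.natCast_eq_zero_iff] at h2
      exact absurd (Nat.le_of_dvd i.succ_pos h2) (by omega)
  · have h1 : ((i + 1 : ℕ) : ZMod m) = 0 := by rw [hi, ZMod.natCast_self]
    push_cast at h1
    rw [dotProduct_comm, Nat.cast_zero, add_zero, show k + 1 + (i : ZMod m) = k by
      linear_combination h1, hk]
  · by_contra hne
    have hcast : ∀ a b : ℕ, (a : ZMod m) = b → a < m → b < m → a = b := fun a b h ha hb => by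
      rwa [ZMod.natCast_eq_natCast_iff', Nat.mod_eq_of_lt ha, Nat.mod_eq_of_lt hb] at h
    have hne' : k + 1 + (i : ZMod m) ≠ k + 1 + j := fun h => by
      have := hcast i j (add_left_cancel h) (by omega) hj
      omega
    rcases hadj _ _ hne' hne with h | h
    · have := hcast j (i + 1) (by push_cast; linear_combination h) hj (by omega)
      omega
    · have h1 : (i : ZMod m) = ((j + 1 : ℕ) : ZMod m) := by push_cast; linear_combination h
      rcases (show j + 1 ≤ m from hj).lt_or_eq with h2 | h2
      · have := hcast _ _ h1 (by omega) h2
        omega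
      · rw [h2, ZMod.natCast_self] at h1
        exact h0 ⟨hcast i 0 (by simpa using h1) (by omega) (by omega), h2⟩

lemma IsCyclicGram.of_dotProduct_eq {ι κ : Type*} [Fintype ι] [Fintype κ] {w : ℕ → ι → ℤ}
    {w' : ℕ → κ → ℤ} (hw : IsCyclicGram m w)
    (h : ∀ i < m, ∀ j < m, i ≠ j → w' i ⬝ᵥ w' j = w i ⬝ᵥ w j) (hm : 2 ≤ m) : IsCyclicGram m w' where
  succ i hi := by rw [h i (by omega) _ hi (by omega), hw.succ i hi]
  ends i hi := by rw [h 0 (by omega) i (by omega) (by omega), hw.ends i hi]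
  ortho i j hij hj h0 := by rw [h i (by omega) j hj (by omega), hw.ortho i j hij hj h0]

lemma count_map_range (f : ℕ → ℕ) (a m : ℕ) :
    ((List.range m).map f).count a = ∑ i ∈ range m, if f i = a then 1 else 0 := by
  induction m with
  | zero => simp
  | succ m ih =>
    rw [List.range_succ, List.map_append, List.count_append, ih, sum_range_succ, List.map_singleton,
      List.count_singleton]
    simp only [beq_iff_eq]

end Listing

/-- Proposition on semipositive circular subsets: under the stated
assumptions, the string of self-intersections of any connected component of `V`
is bounded below (termwise, in absolute value) by an iterated blowup of `(0,0)`
containing exactly two `1`'s. -/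
theorem stmt_2 (N : ℕ) (V : Finset (Fin N → ℤ))
    (hsemi : IsSemipositive N V)
    (hodd : Odd (AddSubgroup.closure (V : Set (Fin N → ℤ))).index)
    (hW : negForm N (∑ v ∈ V, v) (∑ v ∈ V, v) = -(N : ℤ))
    (hsq : ∀ v ∈ V, negForm N v v ≤ -2)
    (hcomp : ∀ v ∈ V,
      (∑ u ∈ compOf N V v, (negForm N u u + 2)) = 4 - ((compOf N V v).card : ℤ) ∧
      (4 : ℤ) - ((compOf N V v).card : ℤ) < -1) :
    ∀ v₀ ∈ V, ∀ (m : ℕ) (w : ZMod m → (Fin N → ℤ)),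
      IsCyclicListing N (compOf N V v₀) m w →
      ∃ s : List ℕ, IsIteratedBlowup s ∧ s.count 1 = 2 ∧
        ∃ h : s.length = m, ∀ i : Fin m,
          (s.get (Fin.cast h.symm i) : ℤ) ≤
            -negForm N (w ((i : ℕ) : ZMod m)) (w ((i : ℕ) : ZMod m)) := by
  intro v₀ hv₀ m w hw
  have hm : 5 < m := by
    have := (hcomp v₀ hv₀).2
    rw [hw.1] at this
    omega
  have : NeZero m := ⟨by omega⟩
  have hC : compOf N V v₀ ∈ components N V := mem_components.2 ⟨v₀, hv₀, rfl⟩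
  have hCV : ∀ i, w i ∈ V := fun i => (mem_compOf.1 (hw.2.2.1 i)).1
  obtain ⟨P, p, hp, q, hq, hpq, hP, hp1, hq1, hother, ⟨a, ha, hap, haq⟩, b, hb, hbp, hbq⟩ :=
    hsemi.exists_projection hodd hW hsq (fun v hv => (hcomp v hv).1) hC
  have hle : ∀ u ∈ compOf N V v₀, P u ⬝ᵥ P u ≤ -negForm N u u := by
    intro u hu
    have h2 := hsq u (mem_compOf.1 hu).1
    by_cases hup : u = p
    · rw [hup] at h2 ⊢
      omega
    by_cases huq : u = q
    · rw [huq] at h2 ⊢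
      omega
    rw [hother u hu hup huq, negForm_eq, neg_neg]
  have hone : ∀ u ∈ compOf N V v₀, (P u ⬝ᵥ P u).toNat = 1 ↔ u = p ∨ u = q := by
    intro u hu
    by_cases hup : u = p
    · simp [hup, hp1]
    by_cases huq : u = q
    · simp [huq, hq1]
    have h2 := hsq u (mem_compOf.1 hu).1
    rw [negForm_eq] at h2
    simp only [hother u hu hup huq, hup, huq, or_self, iff_false]
    omega
  obtain ⟨k, hk⟩ := hw.exists_isCyclicGram hsemi hv₀ (by omega)
  have hgram : IsCyclicGram m fun i : ℕ => P (w (k + i)) := by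
    refine hk.of_dotProduct_eq (fun i hi j hj hij => hP _ (hCV _) _ (hCV _) fun h => hij ?_)
      (by omega)
    have h := add_left_cancel (hw.2.1 h)
    rwa [ZMod.natCast_eq_natCast_iff', Nat.mod_eq_of_lt hi, Nat.mod_eq_of_lt hj] at h
  have hrel : HasRelations m fun i : ℕ => P (w (k + i)) := by
    intro j _
    obtain ⟨c, hcj, ⟨u, hu, hcu⟩, hc⟩ : ∃ c : (Fin N → ℤ) → ℤ, c (w (k + j)) = 0 ∧
        (∃ u ∈ compOf N V v₀, c u ≠ 0) ∧ ∑ u ∈ compOf N V v₀, c u • P u = 0 := by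
      by_cases hbj : b (w (k + j)) = 0
      · exact ⟨b, hbj, ⟨q, hq, hbq⟩, hb⟩
      · refine ⟨fun u => b (w (k + j)) * a u - a (w (k + j)) * b u, by ring,
          ⟨p, hp, by simp [hbp, hbj, hap]⟩, ?_⟩
        simp only [sub_smul, mul_smul, sum_sub_distrib, ← smul_sum, ha, hb, smul_zero, sub_zero]
    rw [hw.sum_eq (fun u => c u • P u) k] at hc
    obtain ⟨i, rfl⟩ := hw.2.2.2.1 u hu
    exact ⟨fun i => c (w (k + i)), hcj, ⟨(i - k).val, ZMod.val_lt _, by simpa using hcu⟩, hc⟩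
  obtain ⟨n, rfl⟩ : ∃ n, m = n + 3 := ⟨m - 3, by omega⟩
  have hblow := hgram.isIteratedBlowup n _ hrel
  refine ⟨_, hblow.rotate (-k).val, ?_, by simp, fun i => ?_⟩
  · classical
    rw [(List.rotate_perm _ _).count_eq, count_map_range,
      ← hw.sum_eq (fun u => if (P u ⬝ᵥ P u).toNat = 1 then 1 else 0) k, ← card_filter,
      ← card_pair hpq]
    congr 1
    ext u
    rw [mem_filter, mem_insert, mem_singleton]
    constructor
    · exact fun h => (hone u h.1).1 h.2
    · intro h
      have hu : u ∈ compOf N V v₀ := by rcases h with rfl | rfl <;> assumption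
      exact ⟨hu, (hone u hu).2 h⟩
  · have hnn : 0 ≤ P (w (i : ℕ)) ⬝ᵥ P (w (i : ℕ)) := sum_nonneg fun _ _ => mul_self_nonneg _
    simp only [List.get_eq_getElem, List.getElem_rotate, List.getElem_map, List.getElem_range,
      List.length_map, List.length_range, Fin.val_cast, ZMod.natCast_mod, Nat.cast_add,
      ZMod.natCast_zmod_val]
    rw [show k + ((i : ℕ) + -k) = ((i : ℕ) : ZMod (n + 3)) by ring, Int.toNat_of_nonneg hnn]
    exact hle _ (hw.2.2.1 _)
end
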